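/- arXiv:1603.05308 — 7 statements merged into one kernel-verified Lean document; each statement's English description precedes it below -/
import Mathlib

section
/- There exists a constant L(d) > 0, depending only on d, such that for every n, for the standard Gaussian measure γ on ℝ^n, and for every polynomial f of degree at most d on ℝ^n, one has γ({x : |f(x) − m_f| ≤ σ_f · s}) ≥ L(d) · s · |ln s|^{−d/2} for every s with 0 < s ≤ 1/2. -/
open MeasureTheory

/-- `f` is a polynomial of degree at most `d` on `ℝ^n`. -/
def IsPolyDeg {n : ℕ} (d : ℕ) (f : EuclideanSpace ℝ (Fin n) → ℝ) : Prop :=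
  ∃ p : MvPolynomial (Fin n) ℝ, p.totalDegree ≤ d ∧
    ∀ x, f x = MvPolynomial.eval (fun i => x i) p

/-- The standard Gaussian measure on `ℝ^n`, with density
`(2π)^{-n/2} exp(-|x|²/2)` with respect to Lebesgue measure. -/
noncomputable def stdGaussian (n : ℕ) : Measure (EuclideanSpace ℝ (Fin n)) :=
  volume.withDensity fun x =>
    ENNReal.ofReal ((2 * Real.pi) ^ (-(n : ℝ) / 2) * Real.exp (-‖x‖ ^ 2 / 2))


noncomputable def trigU : Submodule ℝ (ℝ → ℝ) :=
  Submodule.span ℝ {1, Real.cos, Real.sin}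

lemma trigU_one : (1 : ℝ → ℝ) ∈ trigU := Submodule.subset_span (by simp)
lemma trigU_cos : Real.cos ∈ trigU := Submodule.subset_span (by simp)
lemma trigU_sin : Real.sin ∈ trigU := Submodule.subset_span (by simp)

lemma trigU_mono {a b : ℕ} (h : a ≤ b) : trigU ^ a ≤ trigU ^ b := by
  apply pow_le_pow_right₀ _ h
  rw [Submodule.one_le]
  exact trigU_one

lemma trigU_smooth {d : ℕ} {g : ℝ → ℝ} (hg : g ∈ trigU ^ d) : ContDiff ℝ 1 g := by
  induction hg using Submodule.pow_induction_on_left' with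
  | algebraMap r => exact contDiff_const
  | add x y i hx hy h1 h2 => exact h1.add h2
  | mem_mul m hm i x hx ih =>
    refine ContDiff.mul ?_ ih
    induction hm using Submodule.span_induction with
    | mem x h =>
      rcases h with rfl | rfl | rfl
      · exact contDiff_const
      · exact Real.contDiff_cos
      · exact Real.contDiff_sin
    | zero => exact contDiff_const
    | add x y _ _ h1 h2 => exact h1.add h2
    | smul a x _ h => exact contDiff_const.smul h

lemma trigU_fin (d : ℕ) : FiniteDimensional ℝ ↥(trigU ^ d) := by
  apply Module.Finite.iff_fg.2
  apply Submodule.FG.pow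
  exact Submodule.fg_span (by simp)

lemma exists_sep (V : Submodule ℝ (ℝ → ℝ)) [FiniteDimensional ℝ V] :
    ∃ S : Finset ℝ, ∀ g ∈ V, (∀ t ∈ S, g t = 0) → g = 0 := by
  let K : Finset ℝ → Submodule ℝ V := fun S =>
    ⨅ t ∈ S, LinearMap.ker ((LinearMap.proj t : (ℝ → ℝ) →ₗ[ℝ] ℝ).comp V.subtype)
  obtain ⟨S, hS⟩ := exists_minimal_of_wellFoundedLT (fun W => ∃ S, K S = W) ⟨_, ∅, rfl⟩
  obtain ⟨⟨S, rfl⟩, hmin⟩ := hS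
  have hK : ∀ S (g : V), g ∈ K S ↔ ∀ t ∈ S, (g : ℝ → ℝ) t = 0 := by
    intro S g
    simp [K]
  refine ⟨S, fun g hg h => ?_⟩
  funext t
  have h1 : K (insert t S) ≤ K S := by
    intro g hg
    rw [hK] at hg ⊢
    exact fun t ht => hg t (Finset.mem_insert_of_mem ht)
  have h2 := hmin ⟨_, rfl⟩ h1 (x := ⟨g, hg⟩) ((hK _ _).2 h)
  exact (hK _ _).1 h2 t (Finset.mem_insert_self _ _)

lemma interp (d : ℕ) : ∃ (S : Finset ℝ) (e : S → ℝ → ℝ), (∀ t, ContDiff ℝ 1 (e t)) ∧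
    ∀ g ∈ trigU ^ d, ∀ θ, g θ = ∑ t : S, g t * e t θ := by
  have := trigU_fin d
  obtain ⟨S, hS⟩ := exists_sep (trigU ^ d)
  let ev : ↥(trigU ^ d) →ₗ[ℝ] (S → ℝ) :=
    LinearMap.pi fun t => (LinearMap.proj (t : ℝ) : (ℝ → ℝ) →ₗ[ℝ] ℝ).comp (trigU ^ d).subtype
  have hev : LinearMap.ker ev = ⊥ := by
    rw [LinearMap.ker_eq_bot']
    intro g hg
    apply Subtype.ext
    refine hS g g.2 fun t ht => ?_
    exact congrFun hg ⟨t, ht⟩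
  obtain ⟨L, hL⟩ := LinearMap.exists_leftInverse_of_injective ev hev
  refine ⟨S, fun t => (L (Pi.single t 1) : ℝ → ℝ), fun t => trigU_smooth (L _).2, ?_⟩
  intro g hg θ
  have h1 : L (ev ⟨g, hg⟩) = ⟨g, hg⟩ := LinearMap.congr_fun hL _
  have h2 := pi_eq_sum_univ' (ev ⟨g, hg⟩)
  rw [h2, map_sum] at h1
  have h3 := congrFun (congrArg Subtype.val h1) θ
  simp only [map_smul] at h3
  rw [← h3]
  simp [ev, Finset.sum_apply]

noncomputable def pe {n : ℕ} (p : MvPolynomial (Fin n) ℝ) (x : EuclideanSpace ℝ (Fin n)) : ℝ :=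
  MvPolynomial.eval (fun i => x i) p

lemma pe_cont {n : ℕ} (p : MvPolynomial (Fin n) ℝ) : Continuous (pe p) := by
  unfold pe
  have := MvPolynomial.continuous_eval p
  exact this.comp (by fun_prop)

lemma prod_mem_pow {ι : Type*} (s : Finset ι) (m : ι → ℕ) (u : ι → ℝ → ℝ)
    (hu : ∀ i, u i ∈ trigU) : ∏ i ∈ s, u i ^ m i ∈ trigU ^ (∑ i ∈ s, m i) := by
  classical
  induction s using Finset.induction_on with
  | empty => simp
  | insert a s ha ih =>
    rw [Finset.prod_insert ha, Finset.sum_insert ha, pow_add]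
    exact Submodule.mul_mem_mul (Submodule.pow_mem_pow _ (hu a) _) ih

lemma lin_mem (a b : ℝ) : (fun θ => Real.cos θ * a + Real.sin θ * b) ∈ trigU := by
  have := trigU.add_mem (trigU.smul_mem a trigU_cos) (trigU.smul_mem b trigU_sin)
  convert this using 1
  funext θ
  simp [mul_comm]

lemma path_mem {n d : ℕ} (p : MvPolynomial (Fin n) ℝ) (hp : p.totalDegree ≤ d)
    (x y : EuclideanSpace ℝ (Fin n)) :
    (fun θ : ℝ => pe p (Real.cos θ • x + Real.sin θ • y)) ∈ trigU ^ d := by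
  have : (fun θ : ℝ => pe p (Real.cos θ • x + Real.sin θ • y)) =
      ∑ m ∈ p.support, p.coeff m •
        ∏ i, (fun θ : ℝ => Real.cos θ * x i + Real.sin θ * y i) ^ m i := by
    funext θ
    simp [pe, MvPolynomial.eval_eq', Finset.sum_apply, Finset.prod_apply]
  rw [this]
  refine Submodule.sum_mem _ fun m hm => Submodule.smul_mem _ _ ?_
  refine trigU_mono ?_ (prod_mem_pow Finset.univ m _ fun i => lin_mem _ _)
  refine le_trans ?_ hp
  have := MvPolynomial.le_totalDegree hm
  rwa [Finsupp.sum_fintype _ _ (by simp)] at this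

lemma path_deriv {n : ℕ} (p : MvPolynomial (Fin n) ℝ)
    (x y : EuclideanSpace ℝ (Fin n)) (θ : ℝ) :
    HasDerivAt (fun θ : ℝ => pe p (Real.cos θ • x + Real.sin θ • y))
      (∑ j, pe (MvPolynomial.pderiv j p) (Real.cos θ • x + Real.sin θ • y) *
        (-Real.sin θ • x + Real.cos θ • y : EuclideanSpace ℝ (Fin n)) j) θ := by
  induction p using MvPolynomial.induction_on with
  | C a => simpa [pe] using hasDerivAt_const θ a
  | add p q hp hq =>
    convert! hp.add hq using 1
    · funext θ; simp [pe]
    · rw [← Finset.sum_add_distrib]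
      refine Finset.sum_congr rfl fun j _ => ?_
      simp only [pe, map_add]
      ring
  | mul_X p i hp =>
    have h2 : HasDerivAt (fun θ : ℝ => Real.cos θ * x i + Real.sin θ * y i)
        (-Real.sin θ * x i + Real.cos θ * y i) θ :=
      ((Real.hasDerivAt_cos θ).mul_const _).add ((Real.hasDerivAt_sin θ).mul_const _)
    convert! hp.mul h2 using 1
    · funext θ; simp [pe]
    · simp only [pe, MvPolynomial.pderiv_mul, MvPolynomial.pderiv_X, map_add, map_mul,
        MvPolynomial.eval_X, add_mul, Finset.sum_add_distrib, Finset.sum_mul]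
      congr 1
      · refine Finset.sum_congr rfl fun j _ => ?_
        simp
        ring
      · rw [Finset.sum_eq_single i]
        · simp
        · intro j _ hj
          simp [Pi.single_apply, hj.symm]
        · simp

lemma deg_pderiv {n : ℕ} (p : MvPolynomial (Fin n) ℝ) (j : Fin n) :
    (MvPolynomial.pderiv j p).totalDegree ≤ p.totalDegree - 1 := by
  apply Finset.sup_le
  intro m hm
  rw [MvPolynomial.mem_support_iff, MvPolynomial.coeff_pderiv] at hm
  have h1 : m + Finsupp.single j 1 ∈ p.support := by
    rw [MvPolynomial.mem_support_iff]
    intro h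
    simp [h] at hm
  have := MvPolynomial.le_totalDegree h1
  rw [Finsupp.sum_fintype _ _ (by simp)] at this ⊢
  simp [Finset.sum_add_distrib, Finsupp.single_apply] at this
  omega

lemma dpath_mem {n d : ℕ} (p : MvPolynomial (Fin n) ℝ) (hp : p.totalDegree ≤ d)
    (x y : EuclideanSpace ℝ (Fin n)) :
    (fun θ : ℝ => ∑ j, pe (MvPolynomial.pderiv j p) (Real.cos θ • x + Real.sin θ • y) *
        (-Real.sin θ • x + Real.cos θ • y : EuclideanSpace ℝ (Fin n)) j) ∈ trigU ^ (d + 1) := by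
  have : (fun θ : ℝ => ∑ j, pe (MvPolynomial.pderiv j p) (Real.cos θ • x + Real.sin θ • y) *
        (-Real.sin θ • x + Real.cos θ • y : EuclideanSpace ℝ (Fin n)) j) =
      ∑ j, (fun θ : ℝ => pe (MvPolynomial.pderiv j p) (Real.cos θ • x + Real.sin θ • y)) *
        (fun θ : ℝ => Real.cos θ * y j + Real.sin θ * (- x j)) := by
    funext θ
    simp only [Finset.sum_apply, Pi.mul_apply]
    refine Finset.sum_congr rfl fun j _ => ?_
    congr 1
    simp
    ring
  rw [this]
  refine Submodule.sum_mem _ fun j _ => ?_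
  rw [pow_succ]
  refine Submodule.mul_mem_mul (path_mem _ ?_ _ _) (lin_mem _ _)
  have := deg_pderiv p j
  omega

lemma int_dens (n : ℕ) : Integrable (fun x : EuclideanSpace ℝ (Fin n) =>
    (2 * Real.pi) ^ (-(n : ℝ) / 2) * Real.exp (-‖x‖ ^ 2 / 2)) := by
  apply Integrable.const_mul
  have h := GaussianFourier.integrable_cexp_neg_mul_sq_norm_add (V := EuclideanSpace ℝ (Fin n))
    (b := (1/2 : ℂ)) (by norm_num) 0 0
  have h2 := h.norm
  refine h2.congr (Filter.Eventually.of_forall fun x => ?_)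
  simp only [Complex.norm_exp]
  congr 1
  have : (-(1/2 : ℂ) * (‖x‖ : ℂ) ^ 2 + 0 * ((inner ℝ (0 : EuclideanSpace ℝ (Fin n)) x : ℝ) : ℂ)) = ((-‖x‖ ^ 2 / 2 : ℝ) : ℂ) := by
    push_cast; ring
  exact (congrArg Complex.re this).trans (Complex.ofReal_re _)

lemma stdGaussian_eq (n : ℕ) :
    stdGaussian n = ProbabilityTheory.stdGaussian (EuclideanSpace ℝ (Fin n)) := by
  have hfin : IsFiniteMeasure (stdGaussian n) := by
    exact isFiniteMeasure_withDensity_ofReal (int_dens n).2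
  apply Measure.ext_of_charFun
  funext t
  rw [ProbabilityTheory.charFun_stdGaussian, charFun_apply, stdGaussian,
    integral_withDensity_eq_integral_toReal_smul (by fun_prop)
      (Filter.Eventually.of_forall fun x => ENNReal.ofReal_lt_top)]
  have h := GaussianFourier.integral_cexp_neg_mul_sq_norm_add (V := EuclideanSpace ℝ (Fin n))
    (b := (1/2 : ℂ)) (by norm_num) Complex.I t
  have h3 : ∀ x : EuclideanSpace ℝ (Fin n),
    (ENNReal.ofReal ((2 * Real.pi) ^ (-(n : ℝ) / 2) * Real.exp (-‖x‖ ^ 2 / 2))).toReal •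
      Complex.exp (↑(inner ℝ x t) * Complex.I) =
      (((2 * Real.pi) ^ (-(n : ℝ) / 2) : ℝ) : ℂ) * Complex.exp (-(1/2) * ‖x‖ ^ 2 + Complex.I * ↑(inner ℝ t x)) := by
    intro x
    rw [ENNReal.toReal_ofReal (by positivity), Complex.real_smul, Complex.exp_add, real_inner_comm]
    push_cast
    rw [mul_assoc, mul_comm Complex.I]
    congr 3
    ring
  simp_rw [h3]
  rw [integral_const_mul, h]
  have h4 : ((Real.pi : ℂ) / (1/2)) ^ (Module.finrank ℝ (EuclideanSpace ℝ (Fin n)) / 2 : ℂ) =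
      (((2 * Real.pi) ^ ((n : ℝ) / 2) : ℝ) : ℂ) := by
    rw [Complex.ofReal_cpow (by positivity)]
    simp
    congr 1
    ring
  rw [h4, ← mul_assoc, ← Complex.ofReal_mul, ← Real.rpow_add (by positivity)]
  have : -(n : ℝ) / 2 + n / 2 = 0 := by ring
  rw [this, Real.rpow_zero]
  simp
  congr 1
  ring

noncomputable abbrev gam (n : ℕ) : Measure (EuclideanSpace ℝ (Fin n)) :=
  ProbabilityTheory.stdGaussian (EuclideanSpace ℝ (Fin n))

lemma norm_pow_int {n : ℕ} (k : ℕ) : Integrable (fun x : EuclideanSpace ℝ (Fin n) => ‖x‖ ^ k) (gam n) := by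
  by_cases hk : k = 0
  · subst hk; simp
  have := (ProbabilityTheory.IsGaussian.memLp_id (gam n) k (by simp)).norm_rpow (by simpa using hk) (by simp)
  simpa [memLp_one_iff_integrable] using this

lemma pe_bound {n : ℕ} (p : MvPolynomial (Fin n) ℝ) :
    ∃ (k : ℕ) (C : ℝ), ∀ x, |pe p x| ≤ C * (1 + ‖x‖ ^ k) := by
  induction p using MvPolynomial.induction_on with
  | C a => 
    refine ⟨0, |a|, fun x => ?_⟩
    simp [pe]
    nlinarith [abs_nonneg a]
  | add p q hp hq =>
    obtain ⟨k, C, h⟩ := hp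
    obtain ⟨l, D, h'⟩ := hq
    have key : ∀ (a m : ℕ) (t : ℝ), 0 ≤ t → t ^ a ≤ 1 + t ^ (a + m) := by
      intro a m t ht
      rcases le_total t 1 with h1 | h1
      · have := pow_le_one₀ (n := a) ht h1
        have := pow_nonneg ht (a + m)
        linarith
      · have := pow_le_pow_right₀ h1 (Nat.le_add_right a m)
        linarith
    refine ⟨k + l, 2 * |C| + 2 * |D|, fun x => ?_⟩
    have h1 := key k l ‖x‖ (norm_nonneg x)
    have h2 := key l k ‖x‖ (norm_nonneg x)
    rw [add_comm l k] at h2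
    have e : pe (p + q) x = pe p x + pe q x := by simp [pe]
    rw [e]
    have h3 := abs_add_le (pe p x) (pe q x)
    have hC : C * (1 + ‖x‖ ^ k) ≤ |C| * (2 + 2 * ‖x‖ ^ (k + l)) := by
      apply mul_le_mul (le_abs_self C) _ (by positivity) (abs_nonneg _)
      have : 0 ≤ ‖x‖ ^ (k + l) := by positivity
      linarith
    have hD : D * (1 + ‖x‖ ^ l) ≤ |D| * (2 + 2 * ‖x‖ ^ (k + l)) := by
      apply mul_le_mul (le_abs_self D) _ (by positivity) (abs_nonneg _)
      have : 0 ≤ ‖x‖ ^ (k + l) := by positivity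
      linarith
    linarith [h x, h' x]
  | mul_X p i hp =>
    obtain ⟨k, C, h⟩ := hp
    have key : ∀ (t : ℝ), 0 ≤ t → t ≤ 1 + t ^ (k + 1) := by
      intro t ht
      rcases le_total t 1 with h1 | h1
      · have := pow_nonneg ht (k + 1)
        linarith
      · have := pow_le_pow_right₀ h1 (Nat.le_add_left 1 k)
        linarith
    refine ⟨k + 1, 2 * |C|, fun x => ?_⟩
    have e : pe (p * MvPolynomial.X i) x = pe p x * x i := by simp [pe]
    rw [e, abs_mul]
    have h1 : |x i| ≤ ‖x‖ := by simpa using PiLp.norm_apply_le x i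
    have h2 := key ‖x‖ (norm_nonneg x)
    have h3 : |pe p x| ≤ |C| * (1 + ‖x‖ ^ k) := 
      (h x).trans (mul_le_mul_of_nonneg_right (le_abs_self C) (by positivity))
    calc |pe p x| * |x i| ≤ (|C| * (1 + ‖x‖ ^ k)) * ‖x‖ := by gcongr
      _ = |C| * (‖x‖ + ‖x‖ ^ (k + 1)) := by ring
      _ ≤ |C| * (2 * (1 + ‖x‖ ^ (k + 1))) := by
        have : 0 ≤ ‖x‖ ^ (k + 1) := by positivity
        gcongr; linarith
      _ = _ := by ring

lemma pe_int {n : ℕ} (p : MvPolynomial (Fin n) ℝ) : Integrable (pe p) (gam n) := by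
  obtain ⟨k, C, h⟩ := pe_bound p
  refine Integrable.mono' (((integrable_const 1).add (norm_pow_int k)).const_mul C)
    (pe_cont p).aestronglyMeasurable (Filter.Eventually.of_forall fun x => ?_)
  simpa using h x

lemma rot_mp {n : ℕ} (θ : ℝ) : MeasurePreserving
    (fun z : EuclideanSpace ℝ (Fin n) × EuclideanSpace ℝ (Fin n) =>
      (Real.cos θ • z.1 + Real.sin θ • z.2, -Real.sin θ • z.1 + Real.cos θ • z.2))
    ((gam n).prod (gam n)) ((gam n).prod (gam n)) := by
  refine ⟨by fun_prop, ?_⟩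
  exact ProbabilityTheory.IsGaussian.map_rotation_eq_self 
    (by simp) θ

lemma rot_mp1 {n : ℕ} (θ : ℝ) : MeasurePreserving
    (fun z : EuclideanSpace ℝ (Fin n) × EuclideanSpace ℝ (Fin n) =>
      Real.cos θ • z.1 + Real.sin θ • z.2)
    ((gam n).prod (gam n)) (gam n) :=
  measurePreserving_fst.comp (rot_mp θ)

lemma second_moment {n : ℕ} (i j : Fin n) :
    ∫ y, y i * y j ∂(gam n) = if i = j then 1 else 0 := by
  have h := ProbabilityTheory.covarianceBilin_apply (ProbabilityTheory.IsGaussian.memLp_two_id (μ := gam n)) 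
    (EuclideanSpace.single i (1:ℝ)) (EuclideanSpace.single j 1)
  rw [ProbabilityTheory.covarianceBilin_stdGaussian] at h
  simp only [id, ProbabilityTheory.integral_id_stdGaussian, sub_zero, innerSL_apply_apply ℝ,
    EuclideanSpace.inner_single_left, map_one, one_mul] at h
  rw [← h]
  simp [Pi.single_apply]

lemma c1_bound (e : ℝ → ℝ) (he : ContDiff ℝ 1 e) : ∃ M : ℝ, 0 ≤ M ∧
    (∀ θ ∈ Set.Icc 0 (Real.pi / 2), |e θ| ≤ M) ∧
    (∀ a ∈ Set.Icc 0 (Real.pi / 2), ∀ b ∈ Set.Icc 0 (Real.pi / 2), |e a - e b| ≤ M * |a - b|) ∧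
    |deriv e 0| ≤ M := by
  obtain ⟨M1, h1⟩ := (isCompact_Icc (a := (0:ℝ)) (b := Real.pi / 2)).exists_bound_of_continuousOn
    he.continuous.continuousOn
  obtain ⟨M2, h2⟩ := (isCompact_Icc (a := (0:ℝ)) (b := Real.pi / 2)).exists_bound_of_continuousOn
    (he.continuous_deriv le_rfl).continuousOn
  have h0 : (0:ℝ) ∈ Set.Icc 0 (Real.pi / 2) := ⟨le_rfl, by positivity⟩
  have hM1 : 0 ≤ M1 := (norm_nonneg _).trans (h1 0 h0)
  refine ⟨max M1 M2, hM1.trans (le_max_left _ _), fun θ hθ => (h1 θ hθ).trans (le_max_left _ _), ?_,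
    (h2 0 h0).trans (le_max_right _ _)⟩
  intro a ha b hb
  have := (convex_Icc (0:ℝ) (Real.pi / 2)).norm_image_sub_le_of_norm_deriv_le (f := e)
    (fun x _ => he.differentiable (by norm_num) x) h2 hb ha
  simp only [Real.norm_eq_abs] at this
  exact this.trans (mul_le_mul_of_nonneg_right (le_max_right _ _) (abs_nonneg _))

lemma interp' (d : ℕ) : ∃ (S : Finset ℝ) (M : ℝ), 0 ≤ M ∧ ∀ g ∈ trigU ^ d,
    (∀ θ ∈ Set.Icc 0 (Real.pi / 2), |g θ| ≤ M * ∑ t ∈ S, |g t|) ∧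
    (∀ a ∈ Set.Icc 0 (Real.pi / 2), ∀ b ∈ Set.Icc 0 (Real.pi / 2),
      |g a - g b| ≤ M * (∑ t ∈ S, |g t|) * |a - b|) ∧
    |deriv g 0| ≤ M * ∑ t ∈ S, |g t| := by
  obtain ⟨S, e, he, h⟩ := interp d
  choose M hM h1 h2 h3 using fun t => c1_bound (e t) (he t)
  have hMle : ∀ t, M t ≤ ∑ t, M t := fun t =>
    Finset.single_le_sum (f := M) (fun i _ => hM i) (Finset.mem_univ t)
  refine ⟨S, ∑ t, M t, Finset.sum_nonneg fun i _ => hM i, fun g hg => ?_⟩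
  have hs : ∑ t ∈ S, |g t| = ∑ t : S, |g t| := (Finset.sum_coe_sort S (fun t => |g t|)).symm
  have hgen : ∀ u : S → ℝ, (w : ℝ) → 0 ≤ w → (∀ t, |u t| ≤ M t * w) →
      |∑ t : S, g t * u t| ≤ (∑ t, M t) * (∑ t ∈ S, |g t|) * w := by
    intro u w hw hu
    refine (Finset.abs_sum_le_sum_abs _ _).trans ?_
    rw [hs, mul_assoc, mul_comm, Finset.sum_mul, Finset.sum_mul]
    refine Finset.sum_le_sum fun t _ => ?_
    rw [abs_mul, mul_assoc]
    refine mul_le_mul_of_nonneg_left ((hu t).trans ?_) (abs_nonneg _)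
    rw [mul_comm w]
    exact mul_le_mul_of_nonneg_right (hMle t) hw
  refine ⟨fun θ hθ => ?_, fun a ha b hb => ?_, ?_⟩
  · rw [h g hg θ]
    have := hgen (fun t => e t θ) 1 zero_le_one (fun t => by simpa using h1 t θ hθ)
    simpa using this
  · rw [h g hg a, h g hg b, ← Finset.sum_sub_distrib]
    simp_rw [← mul_sub]
    exact hgen (fun t => e t a - e t b) |a - b| (abs_nonneg _) (fun t => h2 t a ha b hb)
  · have hg' : g = fun θ => ∑ t : S, g t * e t θ := funext (h g hg)
    have hd : deriv g 0 = ∑ t : S, g t * deriv (e t) 0 := by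
      have : HasDerivAt (fun θ => ∑ t : S, g t * e t θ) (∑ t : S, g t * deriv (e t) 0) 0 := by
        apply HasDerivAt.fun_sum
        intro t _
        exact (((he t).differentiable (by norm_num)) 0).hasDerivAt.const_mul _
      rw [← hg'] at this
      exact this.deriv
    rw [hd]
    have := hgen (fun t => deriv (e t) 0) 1 zero_le_one (fun t => by simpa using h3 t)
    simpa using this

lemma sq_sum_abs {S : Finset ℝ} (g : ℝ → ℝ) :
    (∑ t ∈ S, |g t|) ^ 2 ≤ S.card * ∑ t ∈ S, g t ^ 2 := by
  have := sq_sum_le_card_mul_sum_sq (s := S) (f := fun t => |g t|)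
  simpa using this

lemma pe_mul {n : ℕ} (p q : MvPolynomial (Fin n) ℝ) (x) : pe (p * q) x = pe p x * pe q x := by
  simp [pe]
lemma pe_sq {n : ℕ} (p : MvPolynomial (Fin n) ℝ) (x) : pe (p ^ 2) x = pe p x ^ 2 := by
  simp [pe]
lemma pe_sq_int {n : ℕ} (p : MvPolynomial (Fin n) ℝ) :
    Integrable (fun x => pe p x ^ 2) (gam n) :=
  (pe_int (p ^ 2)).congr (Filter.Eventually.of_forall fun x => pe_sq p x)

lemma lin_sq {n : ℕ} (a : Fin n → MvPolynomial (Fin n) ℝ) :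
    Integrable (fun z : EuclideanSpace ℝ (Fin n) × EuclideanSpace ℝ (Fin n) =>
      (∑ j, pe (a j) z.1 * z.2 j) ^ 2) ((gam n).prod (gam n)) ∧
    ∫ z : EuclideanSpace ℝ (Fin n) × EuclideanSpace ℝ (Fin n),
      (∑ j, pe (a j) z.1 * z.2 j) ^ 2 ∂((gam n).prod (gam n)) =
      ∑ j, ∫ x, pe (a j) x ^ 2 ∂(gam n) := by
  have hexp : ∀ z : EuclideanSpace ℝ (Fin n) × EuclideanSpace ℝ (Fin n),
      (∑ j, pe (a j) z.1 * z.2 j) ^ 2 =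
      ∑ j, ∑ k, pe (a j * a k) z.1 * pe (MvPolynomial.X j * MvPolynomial.X k) z.2 := by
    intro z
    rw [sq, Finset.sum_mul_sum]
    refine Finset.sum_congr rfl fun j _ => Finset.sum_congr rfl fun k _ => ?_
    simp [pe]
    ring
  simp_rw [hexp]
  have hinn : ∀ j k, Integrable (fun z : EuclideanSpace ℝ (Fin n) × EuclideanSpace ℝ (Fin n) =>
      pe (a j * a k) z.1 * pe (MvPolynomial.X j * MvPolynomial.X k) z.2) ((gam n).prod (gam n)) :=
    fun j k => (pe_int _).mul_prod (pe_int _)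
  refine ⟨integrable_finsetSum _ fun j _ => integrable_finsetSum _ fun k _ => hinn j k, ?_⟩
  rw [integral_finsetSum _ fun j _ => integrable_finsetSum _ fun k _ => hinn j k]
  refine Finset.sum_congr rfl fun j _ => ?_
  rw [integral_finsetSum _ fun k _ => hinn j k]
  have : ∀ k, ∫ z : EuclideanSpace ℝ (Fin n) × EuclideanSpace ℝ (Fin n),
      pe (a j * a k) z.1 * pe (MvPolynomial.X j * MvPolynomial.X k) z.2 ∂((gam n).prod (gam n))
      = (∫ x, pe (a j * a k) x ∂(gam n)) * if j = k then 1 else 0 := by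
    intro k
    rw [integral_prod_mul, ← second_moment]
    congr 2
    simp [pe]
  simp_rw [this]
  simp [pe_mul, sq]

lemma rot_pe_sq {n : ℕ} (p : MvPolynomial (Fin n) ℝ) (θ : ℝ) :
    Integrable (fun z : EuclideanSpace ℝ (Fin n) × EuclideanSpace ℝ (Fin n) =>
      pe p (Real.cos θ • z.1 + Real.sin θ • z.2) ^ 2) ((gam n).prod (gam n)) ∧
    ∫ z : EuclideanSpace ℝ (Fin n) × EuclideanSpace ℝ (Fin n),
      pe p (Real.cos θ • z.1 + Real.sin θ • z.2) ^ 2 ∂((gam n).prod (gam n)) =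
      ∫ x, pe p x ^ 2 ∂(gam n) := by
  constructor
  · exact (rot_mp1 θ).integrable_comp_of_integrable (pe_sq_int p)
  · have := (rot_mp1 (n := n) θ).map_eq
    conv_rhs => rw [← this]
    rw [integral_map (rot_mp1 θ).measurable.aemeasurable]
    exact ((pe_cont p).pow 2).aestronglyMeasurable

lemma bern_ineq (d : ℕ) : ∃ B : ℝ, 0 ≤ B ∧ ∀ (n : ℕ) (p : MvPolynomial (Fin n) ℝ),
    p.totalDegree ≤ d →
    ∑ j, ∫ x, pe (MvPolynomial.pderiv j p) x ^ 2 ∂(gam n) ≤ B * ∫ x, pe p x ^ 2 ∂(gam n) := by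
  obtain ⟨S, M, hM, h⟩ := interp' d
  refine ⟨M ^ 2 * (S.card * S.card), by positivity, fun n p hp => ?_⟩
  obtain ⟨hi, he⟩ := lin_sq (fun j => MvPolynomial.pderiv j p)
  rw [← he]
  have hle : ∀ z : EuclideanSpace ℝ (Fin n) × EuclideanSpace ℝ (Fin n),
      (∑ j, pe (MvPolynomial.pderiv j p) z.1 * z.2 j) ^ 2 ≤
      M ^ 2 * (S.card * ∑ t ∈ S, pe p (Real.cos t • z.1 + Real.sin t • z.2) ^ 2) := by
    intro z
    have h1 := (h _ (path_mem p hp z.1 z.2)).2.2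
    rw [(path_deriv p z.1 z.2 0).deriv] at h1
    simp at h1
    rw [← sq_abs]
    refine (pow_le_pow_left₀ (abs_nonneg _) h1 2).trans ?_
    rw [mul_pow]
    refine mul_le_mul_of_nonneg_left ?_ (by positivity)
    exact sq_sum_abs fun t => pe p (Real.cos t • z.1 + Real.sin t • z.2)
  refine (integral_mono hi ?_ hle).trans ?_
  · exact ((integrable_finsetSum _ fun t _ => (rot_pe_sq p t).1).const_mul _).const_mul _
  · rw [integral_const_mul, integral_const_mul,
      integral_finsetSum _ fun t _ => (rot_pe_sq p t).1]
    simp_rw [(rot_pe_sq p _).2]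
    simp
    apply le_of_eq; ring

lemma rot_lin_sq {n : ℕ} (a : Fin n → MvPolynomial (Fin n) ℝ) (θ : ℝ) :
    Integrable (fun z : EuclideanSpace ℝ (Fin n) × EuclideanSpace ℝ (Fin n) =>
      (∑ j, pe (a j) (Real.cos θ • z.1 + Real.sin θ • z.2) *
        (-Real.sin θ • z.1 + Real.cos θ • z.2 : EuclideanSpace ℝ (Fin n)) j) ^ 2)
      ((gam n).prod (gam n)) ∧
    ∫ z : EuclideanSpace ℝ (Fin n) × EuclideanSpace ℝ (Fin n),
      (∑ j, pe (a j) (Real.cos θ • z.1 + Real.sin θ • z.2) *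
        (-Real.sin θ • z.1 + Real.cos θ • z.2 : EuclideanSpace ℝ (Fin n)) j) ^ 2
        ∂((gam n).prod (gam n)) =
      ∑ j, ∫ x, pe (a j) x ^ 2 ∂(gam n) := by
  constructor
  · exact (rot_mp θ).integrable_comp_of_integrable (lin_sq a).1
  · rw [← (lin_sq a).2]
    have := (rot_mp (n := n) θ).map_eq
    conv_rhs => rw [← this]
    rw [integral_map (rot_mp θ).measurable.aemeasurable]
    rw [this]
    exact (lin_sq a).1.aestronglyMeasurable

lemma poincare (d : ℕ) : ∃ C : ℝ, 0 ≤ C ∧ ∀ (n : ℕ) (p : MvPolynomial (Fin n) ℝ),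
    p.totalDegree ≤ d →
    ∫ x, pe p x ^ 2 ∂(gam n) ≤ (∫ x, pe p x ∂(gam n)) ^ 2 +
      C * ∑ j, ∫ x, pe (MvPolynomial.pderiv j p) x ^ 2 ∂(gam n) := by
  obtain ⟨S, M, hM, h⟩ := interp' (d + 1)
  refine ⟨(Real.pi / 2) ^ 2 * (M ^ 2 * (S.card * S.card)), by positivity, fun n p hp => ?_⟩
  have hle : ∀ z : EuclideanSpace ℝ (Fin n) × EuclideanSpace ℝ (Fin n),
      (pe p z.2 - pe p z.1) ^ 2 ≤ (Real.pi / 2) ^ 2 * (M ^ 2 *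
      (S.card * ∑ t ∈ S, (∑ j, pe (MvPolynomial.pderiv j p) (Real.cos t • z.1 + Real.sin t • z.2) *
        (-Real.sin t • z.1 + Real.cos t • z.2 : EuclideanSpace ℝ (Fin n)) j) ^ 2)) := by
    intro z
    have h1 := (h _ (dpath_mem p hp z.1 z.2)).1
    have h0 : (0:ℝ) ≤ Real.pi / 2 := by positivity
    have h2 := (convex_Icc (0:ℝ) (Real.pi / 2)).norm_image_sub_le_of_norm_hasDerivWithin_le
      (fun x _ => (path_deriv p z.1 z.2 x).hasDerivWithinAt) h1
      (Set.left_mem_Icc.2 h0) (Set.right_mem_Icc.2 h0)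
    simp only [Real.cos_zero, Real.sin_zero, Real.cos_pi_div_two, Real.sin_pi_div_two,
      zero_smul, one_smul, zero_add, add_zero, sub_zero, Real.norm_eq_abs,
      abs_of_nonneg h0] at h2
    rw [← sq_abs]
    refine (pow_le_pow_left₀ (abs_nonneg _) h2 2).trans ?_
    rw [mul_pow, mul_pow, mul_comm]
    refine mul_le_mul_of_nonneg_left ?_ (by positivity)
    refine mul_le_mul_of_nonneg_left ?_ (by positivity)
    exact sq_sum_abs fun t => (∑ j, pe (MvPolynomial.pderiv j p) (Real.cos t • z.1 + Real.sin t • z.2) *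
        (-Real.sin t • z.1 + Real.cos t • z.2 : EuclideanSpace ℝ (Fin n)) j)
  have hexp : ∀ z : EuclideanSpace ℝ (Fin n) × EuclideanSpace ℝ (Fin n),
      (pe p z.2 - pe p z.1) ^ 2 = pe p z.2 ^ 2 + pe p z.1 ^ 2 - 2 * (pe p z.1 * pe p z.2) := by
    intro z; ring
  have i1 : Integrable (fun z : EuclideanSpace ℝ (Fin n) × EuclideanSpace ℝ (Fin n) => pe p z.1 ^ 2)
      ((gam n).prod (gam n)) := (pe_sq_int p).comp_fst _
  have i2 : Integrable (fun z : EuclideanSpace ℝ (Fin n) × EuclideanSpace ℝ (Fin n) => pe p z.2 ^ 2)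
      ((gam n).prod (gam n)) := (pe_sq_int p).comp_snd _
  have i3 : Integrable (fun z : EuclideanSpace ℝ (Fin n) × EuclideanSpace ℝ (Fin n) =>
      2 * (pe p z.1 * pe p z.2)) ((gam n).prod (gam n)) := ((pe_int p).mul_prod (pe_int p)).const_mul 2
  have hL : ∫ z : EuclideanSpace ℝ (Fin n) × EuclideanSpace ℝ (Fin n),
      (pe p z.2 - pe p z.1) ^ 2 ∂((gam n).prod (gam n)) =
      2 * (∫ x, pe p x ^ 2 ∂(gam n) - (∫ x, pe p x ∂(gam n)) ^ 2) := by
    simp_rw [hexp]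
    have i12 : Integrable (fun z : EuclideanSpace ℝ (Fin n) × EuclideanSpace ℝ (Fin n) =>
      pe p z.2 ^ 2 + pe p z.1 ^ 2) ((gam n).prod (gam n)) := i2.add i1
    rw [integral_sub i12 i3, integral_add i2 i1, integral_const_mul, integral_prod_mul]
    rw [integral_fun_fst (fun x => pe p x ^ 2), integral_fun_snd (fun x => pe p x ^ 2)]
    simp
    ring
  have hI : Integrable (fun z : EuclideanSpace ℝ (Fin n) × EuclideanSpace ℝ (Fin n) =>
      (pe p z.2 - pe p z.1) ^ 2) ((gam n).prod (gam n)) := by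
    simp_rw [hexp]
    exact (i2.add i1).sub i3
  have hfin := integral_mono hI ?_ hle
  · rw [hL, integral_const_mul, integral_const_mul, integral_const_mul,
      integral_finsetSum _ fun t _ => (rot_lin_sq (fun j => MvPolynomial.pderiv j p) t).1] at hfin
    simp_rw [(rot_lin_sq (fun j => MvPolynomial.pderiv j p) _).2] at hfin
    simp only [Finset.sum_const, nsmul_eq_mul] at hfin
    have hnn : 0 ≤ ((Real.pi / 2) ^ 2 * (M ^ 2 * (S.card * S.card))) *
       ∑ j, ∫ x, pe (MvPolynomial.pderiv j p) x ^ 2 ∂(gam n) := by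
      refine mul_nonneg (by positivity) (Finset.sum_nonneg fun j _ => ?_)
      exact integral_nonneg fun x => sq_nonneg _
    nlinarith
  · exact (((integrable_finsetSum _ fun t _ =>
      (rot_lin_sq (fun j => MvPolynomial.pderiv j p) t).1).const_mul _).const_mul _).const_mul _

theorem hyper (d : ℕ) : ∃ K : ℝ, 0 ≤ K ∧ ∀ (n : ℕ) (ι : Type) [Fintype ι]
    (F : ι → MvPolynomial (Fin n) ℝ), (∀ i, (F i).totalDegree ≤ d) →
    ∫ x, pe (∑ i, F i ^ 2) x ^ 2 ∂(gam n) ≤ K * (∫ x, pe (∑ i, F i ^ 2) x ∂(gam n)) ^ 2 := by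
  induction d with
  | zero =>
    refine ⟨1, zero_le_one, fun n ι _ F hF => ?_⟩
    have h : ∀ i, F i = MvPolynomial.C ((F i).coeff 0) := fun i =>
      MvPolynomial.totalDegree_eq_zero_iff_eq_C.1 (Nat.le_zero.1 (hF i))
    have h2 : ∀ x, pe (∑ i, F i ^ 2) x = ∑ i, (F i).coeff 0 ^ 2 := by
      intro x
      unfold pe
      rw [map_sum]
      refine Finset.sum_congr rfl fun i _ => ?_
      rw [h i]
      simp
    simp [h2]
  | succ d ih =>
    obtain ⟨K, hK, ih⟩ := ih
    obtain ⟨C, hC, hP⟩ := poincare (2 * (d + 1))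
    obtain ⟨B, hB, hBe⟩ := bern_ineq (d + 1)
    refine ⟨2 + 16 * C ^ 2 * (K * B ^ 2), by positivity, fun n ι _ F hF => ?_⟩
    set Q := ∑ i, F i ^ 2 with hQ
    set R := ∑ k : ι × Fin n, (MvPolynomial.pderiv k.2 (F k.1)) ^ 2 with hR
    have hQd : Q.totalDegree ≤ 2 * (d + 1) := by
      refine (MvPolynomial.totalDegree_finsetSum _ _).trans ?_
      refine Finset.sup_le fun i _ => ?_
      exact (MvPolynomial.totalDegree_pow _ _).trans (Nat.mul_le_mul_left 2 (hF i))
    have h1 := hP n Q hQd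
    have h2 := ih n (ι × Fin n) (fun k => MvPolynomial.pderiv k.2 (F k.1)) (fun k => by
      have := deg_pderiv (F k.1) k.2
      have := hF k.1
      omega)
    rw [← hR] at h2
    have hQx : ∀ x, pe Q x = ∑ i, pe (F i) x ^ 2 := by
      intro x; simp [hQ, pe]
    have hRx : ∀ x, pe R x = ∑ j, ∑ i, pe (MvPolynomial.pderiv j (F i)) x ^ 2 := by
      intro x
      rw [hR, Finset.sum_comm, ← Fintype.sum_prod_type']
      simp [pe]
    have h3 : ∫ x, pe R x ∂(gam n) ≤ B * ∫ x, pe Q x ∂(gam n) := by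
      simp_rw [hRx, hQx]
      rw [integral_finsetSum _ fun j _ => integrable_finsetSum _ fun i _ => pe_sq_int _,
        integral_finsetSum _ fun i _ => pe_sq_int _]
      simp_rw [integral_finsetSum _ fun i _ => pe_sq_int _]
      rw [Finset.sum_comm, Finset.mul_sum]
      exact Finset.sum_le_sum fun i _ => hBe n (F i) (hF i)
    have h3' : 0 ≤ ∫ x, pe R x ∂(gam n) := by
      apply integral_nonneg
      intro x
      simp only [Pi.zero_apply]
      rw [hRx]
      positivity
    have hder : ∀ j x, pe (MvPolynomial.pderiv j Q) x ^ 2 ≤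
        4 * (pe Q x * ∑ i, pe (MvPolynomial.pderiv j (F i)) x ^ 2) := by
      intro j x
      have : pe (MvPolynomial.pderiv j Q) x =
          2 * ∑ i, pe (F i) x * pe (MvPolynomial.pderiv j (F i)) x := by
        rw [Finset.mul_sum]
        simp [hQ, pe, map_sum, MvPolynomial.pderiv_pow, mul_assoc]
      rw [this, mul_pow, hQx]
      have := Finset.sum_mul_sq_le_sq_mul_sq Finset.univ (fun i => pe (F i) x)
        (fun i => pe (MvPolynomial.pderiv j (F i)) x)
      nlinarith
    have h4 : C * ∑ j, ∫ x, pe (MvPolynomial.pderiv j Q) x ^ 2 ∂(gam n) ≤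
        (∫ x, pe Q x ^ 2 ∂(gam n)) / 2 + 8 * C ^ 2 * ∫ x, pe R x ^ 2 ∂(gam n) := by
      rw [← integral_finsetSum _ fun i _ => pe_sq_int _, ← integral_const_mul, ← integral_div,
        ← integral_const_mul, ← integral_add ((pe_sq_int _).div_const _) ((pe_sq_int _).const_mul _)]
      refine integral_mono ((integrable_finsetSum _ fun i _ => pe_sq_int _).const_mul _)
        (((pe_sq_int _).div_const _).add ((pe_sq_int _).const_mul _)) fun x => ?_
      have : ∑ j, pe (MvPolynomial.pderiv j Q) x ^ 2 ≤ 4 * (pe Q x * pe R x) := by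
        rw [hRx, Finset.mul_sum, Finset.mul_sum]
        exact Finset.sum_le_sum fun j _ => hder j x
      have := mul_le_mul_of_nonneg_left this hC
      simp only
      nlinarith [sq_nonneg (pe Q x - 4 * C * pe R x)]
    have h5 : (∫ x, pe R x ∂(gam n)) ^ 2 ≤ B ^ 2 * (∫ x, pe Q x ∂(gam n)) ^ 2 := by
      rw [← mul_pow]
      exact pow_le_pow_left₀ h3' h3 2
    have h6 : ∫ x, pe R x ^ 2 ∂(gam n) ≤ K * (B ^ 2 * (∫ x, pe Q x ∂(gam n)) ^ 2) :=
      h2.trans (mul_le_mul_of_nonneg_left h5 hK)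
    have h7 := mul_le_mul_of_nonneg_left h6 (by positivity : 0 ≤ 16 * C ^ 2)
    linarith

set_option maxHeartbeats 1600000 in
lemma pos_prob (d : ℕ) : ∃ c : ℝ, 0 < c ∧ ∀ (n : ℕ) (q : MvPolynomial (Fin n) ℝ),
    q.totalDegree ≤ d → ∫ x, pe q x ∂(gam n) = 0 → 0 < ∫ x, pe q x ^ 2 ∂(gam n) →
    c ≤ (gam n).real {x | 0 < pe q x} := by
  obtain ⟨K₀, hK₀, hyp⟩ := hyper d
  set K := K₀ + 1 with hKdef
  have hK : 0 < K := by positivity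
  set r := Real.sqrt (2 * K) with hr
  have hr0 : 0 < r := Real.sqrt_pos.2 (by positivity)
  have hr2 : r ^ 2 = 2 * K := Real.sq_sqrt (by positivity)
  refine ⟨(1 / (2 * r)) ^ 2 / 4, by positivity, fun n q hq hm hv => ?_⟩
  have h4 := hyp n Unit (fun _ => q) (fun _ => hq)
  simp only [Finset.univ_unique, Finset.sum_const, Finset.card_singleton, one_smul, pe_sq] at h4
  set v := ∫ x, pe q x ^ 2 ∂(gam n) with hvdef
  set σ := Real.sqrt v with hσ
  have hσ0 : 0 < σ := Real.sqrt_pos.2 hv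
  have hσ2 : σ ^ 2 = v := Real.sq_sqrt hv.le
  have h4' : ∫ x, (pe q x ^ 2) ^ 2 ∂(gam n) ≤ K * v ^ 2 := by
    have : 0 ≤ v ^ 2 := by positivity
    rw [hKdef]
    linarith
  have i4 : Integrable (fun x => (pe q x ^ 2) ^ 2) (gam n) := by
    have := pe_sq_int (q ^ 2)
    simpa only [pe_sq] using this
  have i1 : Integrable (fun x => |pe q x|) (gam n) := (pe_int q).abs
  have ha : 0 < r * σ := by positivity
  have hE : v ≤ (r * σ) * ∫ x, |pe q x| ∂(gam n) + (∫ x, (pe q x ^ 2) ^ 2 ∂(gam n)) / (r * σ) ^ 2 := by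
    rw [hvdef, ← integral_const_mul, ← integral_div, ← integral_add (i1.const_mul _) (i4.div_const _)]
    refine integral_mono (pe_sq_int q) ((i1.const_mul _).add (i4.div_const _)) fun x => ?_
    simp only
    rw [← sq_abs (pe q x)]
    have ht := abs_nonneg (pe q x)
    generalize |pe q x| = t at ht
    generalize r * σ = a at ha
    rcases le_total t a with h | h
    · have : 0 ≤ (t ^ 2) ^ 2 / a ^ 2 := by positivity
      nlinarith
    · have h5 : t ^ 2 ≤ (t ^ 2) ^ 2 / a ^ 2 := by
        rw [le_div_iff₀ (by positivity), sq (t ^ 2)]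
        exact mul_le_mul_of_nonneg_left (pow_le_pow_left₀ ha.le h 2) (by positivity)
      have : 0 ≤ a * t := by positivity
      linarith
  have hE2 : (∫ x, (pe q x ^ 2) ^ 2 ∂(gam n)) / (r * σ) ^ 2 ≤ v / 2 := by
    rw [div_le_iff₀ (by positivity), mul_pow, hr2, hσ2]
    linarith
  set c1 := 1 / (2 * r) with hc1
  have hA : c1 * σ ≤ ∫ x, |pe q x| ∂(gam n) := by
    have : r * σ * (c1 * σ) = v / 2 := by
      rw [hc1, ← hσ2]; field_simp
    have h6 : r * σ * (c1 * σ) ≤ r * σ * ∫ x, |pe q x| ∂(gam n) := by linarith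
    exact le_of_mul_le_mul_left h6 ha
  have hc1p : 0 < c1 := by positivity
  -- now positive part
  have hms : MeasurableSet {x | 0 < pe q x} := (isOpen_lt continuous_const (pe_cont q)).measurableSet
  set b := c1 / (2 * σ) with hb
  have hb0 : 0 < b := by positivity
  clear_value b
  have iind : Integrable ({x | 0 < pe q x}.indicator (fun _ => (1:ℝ))) (gam n) :=
    (integrable_const 1).indicator hms
  have hF : ∫ x, (|pe q x| + pe q x) ∂(gam n) ≤
      ∫ x, (b * pe q x ^ 2 + {x | 0 < pe q x}.indicator (fun _ => (1:ℝ)) x / b) ∂(gam n) := by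
    refine integral_mono (i1.add (pe_int q)) (((pe_sq_int q).const_mul b).add (iind.div_const b))
      fun x => ?_
    simp only
    by_cases h : 0 < pe q x
    · rw [Set.indicator_of_mem (by exact h), abs_of_pos h]
      have : 0 ≤ (b * pe q x - 1) ^ 2 / b := by positivity
      have e : (b * pe q x - 1) ^ 2 / b = b * pe q x ^ 2 + 1 / b - 2 * pe q x := by
        field_simp; ring
      linarith
    · rw [Set.indicator_of_notMem (by exact h), abs_of_nonpos (not_lt.1 h)]
      have : 0 ≤ b * pe q x ^ 2 := by positivity
      simp
      linarith
  rw [integral_add i1 (pe_int q), hm, integral_add ((pe_sq_int q).const_mul b) (iind.div_const b),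
    integral_const_mul, integral_div, integral_indicator_const _ hms, ← hvdef] at hF
  simp only [smul_eq_mul, mul_one, add_zero] at hF
  have hbv : b * v = c1 * σ / 2 := by
    rw [hb, ← hσ2]; field_simp
  have : c1 * σ / 2 ≤ (gam n).real {x | 0 < pe q x} / b := by linarith
  rw [le_div_iff₀ hb0] at this
  have e : c1 * σ / 2 * b = c1 ^ 2 / 4 := by
    rw [hb]; field_simp; ring
  linarith

set_option maxHeartbeats 1600000 in
lemma small_ball (d : ℕ) : ∃ c : ℝ, 0 < c ∧ ∀ (n : ℕ) (q : MvPolynomial (Fin n) ℝ),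
    q.totalDegree ≤ d → ∫ x, pe q x ∂(gam n) = 0 → 0 < ∫ x, pe q x ^ 2 ∂(gam n) →
    ∀ s : ℝ, 0 < s → s ≤ 1 / 2 →
    ENNReal.ofReal (c * s) ≤
      gam n {x | |pe q x| ≤ Real.sqrt (∫ x, pe q x ^ 2 ∂(gam n)) * s} := by
  obtain ⟨c0, hc0, hpos⟩ := pos_prob d
  obtain ⟨S, M, hM, hinn⟩ := interp' d
  set N : ℝ := (S.card : ℝ) with hN
  have hN0 : 0 ≤ N := by positivity
  set c2 := c0 ^ 2 with hc2
  have hc2p : 0 < c2 := by positivity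
  set K := 2 * (N + 1) / c2 with hK
  have hKp : 0 < K := by positivity
  set T := M * Real.sqrt (N * K) + 1 with hT
  have hT1 : 1 ≤ T := by
    have : 0 ≤ M * Real.sqrt (N * K) := by positivity
    linarith
  have hT0 : 0 < T := by linarith
  clear_value T K c2 N
  refine ⟨c2 / 2 / T / (Real.pi / 2), by positivity, fun n q hq hm hv s hs hs2 => ?_⟩
  set v := ∫ x, pe q x ^ 2 ∂(gam n) with hvdef
  set σ := Real.sqrt v with hσ
  have hσ0 : 0 < σ := Real.sqrt_pos.2 hv
  have hσ2 : σ ^ 2 = v := Real.sq_sqrt hv.le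
  -- the good event
  have hA := hpos n q hq hm hv
  have hB : c0 ≤ (gam n).real {x | pe q x < 0} := by
    have e : ∀ x, pe (-q) x = - pe q x := fun x => by simp [pe]
    have := hpos n (-q) (by simpa using hq) (by simp_rw [e]; rw [integral_neg, hm, neg_zero])
      (by simp_rw [e]; simpa using hv)
    simpa [e] using this
  clear_value σ v
  set P := (gam n).prod (gam n) with hPdef
  set W : EuclideanSpace ℝ (Fin n) × EuclideanSpace ℝ (Fin n) → ℝ := fun z =>
    ∑ t ∈ S, pe q (Real.cos t • z.1 + Real.sin t • z.2) ^ 2 with hW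
  have hWi : Integrable W P := integrable_finsetSum _ fun t _ => (rot_pe_sq q t).1
  have hWe : ∫ z, W z ∂P = N * v := by
    rw [hW, integral_finsetSum _ fun t _ => (rot_pe_sq q t).1]
    rw [Finset.sum_congr rfl fun t _ => (rot_pe_sq q t).2]
    rw [Finset.sum_const, nsmul_eq_mul, hN, hvdef]
  have hWc : Continuous W := by
    refine continuous_finsetSum _ fun t _ => ((pe_cont q).comp ?_).pow 2
    fun_prop
  have hMk : P.real {z | K * v ≤ W z} ≤ c2 / 2 := by
    have := mul_meas_ge_le_integral_of_nonneg (μ := P)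
      (Filter.Eventually.of_forall fun z => Finset.sum_nonneg fun t _ => sq_nonneg _) hWi (K * v)
    rw [hWe] at this
    have h2 : K * v * P.real {z | K * v ≤ W z} ≤ K * v * (c2 / 2) := by
      refine this.trans ?_
      have : K * v * (c2 / 2) = (N + 1) * v := by
        rw [hK]; field_simp
      rw [this]
      nlinarith
    exact le_of_mul_le_mul_left h2 (by positivity)
  set G := ({x | pe q x < 0} ×ˢ {x | 0 < pe q x} : Set (EuclideanSpace ℝ (Fin n) × EuclideanSpace ℝ (Fin n)))
    with hG
  have hGm : MeasurableSet G :=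
    (isOpen_lt (pe_cont q) continuous_const).measurableSet.prod
      (isOpen_lt continuous_const (pe_cont q)).measurableSet
  have hGp : c2 ≤ P.real G := by
    rw [hG, hPdef, measureReal_prod_prod, hc2, sq]
    exact mul_le_mul hB hA hc0.le measureReal_nonneg
  set H := G \ {z | K * v ≤ W z} with hH
  have hHm : MeasurableSet H := hGm.diff (isClosed_le continuous_const hWc).measurableSet
  have hHp : c2 / 2 ≤ P.real H := by
    have := le_measureReal_sdiff (μ := P) (s₁ := G) (s₂ := {z | K * v ≤ W z})
    linarith
  -- the set of pairs
  set ℓ := s / T with hℓ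
  have hℓ0 : 0 < ℓ := by positivity
  clear_value ℓ
  have hℓ1 : ℓ ≤ 1 / 2 := by
    rw [hℓ, div_le_iff₀ hT0]; nlinarith
  set lam : Measure ℝ := volume.restrict (Set.Icc 0 (Real.pi / 2)) with hlam
  have hpi := Real.pi_gt_three
  have hline : ∀ z ∈ H, ENNReal.ofReal ℓ ≤
      lam {θ | |pe q (Real.cos θ • z.1 + Real.sin θ • z.2)| ≤ σ * s} := by
    intro z hz
    set g : ℝ → ℝ := fun θ => pe q (Real.cos θ • z.1 + Real.sin θ • z.2) with hg
    have hgm := path_mem q hq z.1 z.2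
    have hgc : Continuous g := (trigU_smooth hgm).continuous
    have g0 : g 0 < 0 := by simpa [hg] using hz.1.1
    have g1 : 0 < g (Real.pi / 2) := by simpa [hg] using hz.1.2
    obtain ⟨θ₀, hθ₀, hz0⟩ := intermediate_value_Icc (by positivity : (0:ℝ) ≤ Real.pi / 2)
      hgc.continuousOn (show (0:ℝ) ∈ Set.Icc _ _ from ⟨g0.le, g1.le⟩)
    have hWz : W z ≤ K * v := (not_le.1 hz.2).le
    have hsum : ∑ t ∈ S, |g t| ≤ Real.sqrt (N * K) * σ := by
      rw [hσ, ← Real.sqrt_mul (by positivity)]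
      apply Real.le_sqrt_of_sq_le
      refine (sq_sum_abs g).trans ?_
      rw [mul_assoc, ← hN]
      exact mul_le_mul_of_nonneg_left hWz hN0
    have hlip : ∀ a ∈ Set.Icc 0 (Real.pi / 2), |a - θ₀| ≤ ℓ → |g a| ≤ σ * s := by
      intro a ha hd
      have h1 := (hinn g hgm).2.1 a ha θ₀ hθ₀
      rw [hz0, sub_zero] at h1
      have h2 : M * ∑ t ∈ S, |g t| ≤ T * σ := by
        have := mul_le_mul_of_nonneg_left hsum hM
        rw [hT]; nlinarith
      calc |g a| ≤ (M * ∑ t ∈ S, |g t|) * |a - θ₀| := h1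
        _ ≤ (T * σ) * ℓ := mul_le_mul h2 hd (abs_nonneg _) (mul_pos hT0 hσ0).le
        _ = σ * s := by rw [hℓ]; field_simp
    have hmeas : MeasurableSet {θ | |g θ| ≤ σ * s} :=
      (isClosed_le hgc.abs continuous_const).measurableSet
    rw [hlam, Measure.restrict_apply hmeas]
    rcases le_total θ₀ (Real.pi / 4) with h | h
    · calc ENNReal.ofReal ℓ = volume (Set.Icc θ₀ (θ₀ + ℓ)) := by simp
        _ ≤ _ := by
          apply measure_mono
          intro a ha
          have hI : a ∈ Set.Icc 0 (Real.pi / 2) := ⟨hθ₀.1.trans ha.1, by linarith [ha.2]⟩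
          exact ⟨hlip a hI (abs_le.2 ⟨by linarith [ha.1], by linarith [ha.2]⟩), hI⟩
    · calc ENNReal.ofReal ℓ = volume (Set.Icc (θ₀ - ℓ) θ₀) := by simp
        _ ≤ _ := by
          apply measure_mono
          intro a ha
          have hI : a ∈ Set.Icc 0 (Real.pi / 2) := ⟨by linarith [ha.1], ha.2.trans hθ₀.2⟩
          exact ⟨hlip a hI (abs_le.2 ⟨by linarith [ha.1], by linarith [ha.2]⟩), hI⟩
  set D : Set (ℝ × (EuclideanSpace ℝ (Fin n) × EuclideanSpace ℝ (Fin n))) :=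
    {w | |pe q (Real.cos w.1 • w.2.1 + Real.sin w.1 • w.2.2)| ≤ σ * s} with hD
  have hDm : MeasurableSet D := by
    refine (isClosed_le (Continuous.abs ((pe_cont q).comp ?_)) continuous_const).measurableSet
    fun_prop
  have hqm : MeasurableSet {x | |pe q x| ≤ σ * s} :=
    (isClosed_le (pe_cont q).abs continuous_const).measurableSet
  have e1 : (lam.prod P) D = gam n {x | |pe q x| ≤ σ * s} * ENNReal.ofReal (Real.pi / 2) := by
    rw [Measure.prod_apply hDm]
    have : ∀ θ, P (Prod.mk θ ⁻¹' D) = gam n {x | |pe q x| ≤ σ * s} := fun θ =>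
      (rot_mp1 (n := n) θ).measure_preimage hqm.nullMeasurableSet
    simp_rw [this]
    rw [lintegral_const, hlam]
    simp
  have e2 : ENNReal.ofReal ℓ * ENNReal.ofReal (c2 / 2) ≤ (lam.prod P) D := by
    rw [Measure.prod_apply_symm hDm]
    calc ENNReal.ofReal ℓ * ENNReal.ofReal (c2 / 2) ≤ ENNReal.ofReal ℓ * P H := by
          gcongr
          rw [← ofReal_measureReal]
          exact ENNReal.ofReal_le_ofReal hHp
      _ = ∫⁻ z in H, ENNReal.ofReal ℓ ∂P := by simp
      _ ≤ ∫⁻ z in H, lam ((fun θ => (θ, z)) ⁻¹' D) ∂P := setLIntegral_mono' hHm hline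
      _ ≤ _ := setLIntegral_le_lintegral _ _
  rw [e1, ← ENNReal.ofReal_mul hℓ0.le] at e2
  have hpp : 0 < Real.pi / 2 := by positivity
  have e3 : c2 / 2 / T / (Real.pi / 2) * s = ℓ * (c2 / 2) / (Real.pi / 2) := by
    rw [hℓ]; field_simp
  rw [e3, ENNReal.ofReal_div_of_pos hpp]
  exact ENNReal.div_le_of_le_mul e2

/-- There is `L(d) > 0` such that for the standard Gaussian measure `γ` on `ℝ^n`
and every polynomial `f` of degree at most `d`,
`γ(|f - m_f| ≤ σ_f s) ≥ L(d) s |ln s|^{-d/2}` for `0 < s ≤ 1/2`. -/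
theorem gaussian_small_deviation_lower_bound (d : ℕ) :
    ∃ L : ℝ, 0 < L ∧
      ∀ (n : ℕ) (f : EuclideanSpace ℝ (Fin n) → ℝ), IsPolyDeg d f →
        ∀ s : ℝ, 0 < s → s ≤ 1 / 2 →
          ENNReal.ofReal (L * s * |Real.log s| ^ (-(d : ℝ) / 2)) ≤
            stdGaussian n {x |
              |f x - ∫ y, f y ∂(stdGaussian n)| ≤
                Real.sqrt (∫ y, (f y - ∫ z, f z ∂(stdGaussian n)) ^ 2 ∂(stdGaussian n)) * s} := by
  obtain ⟨c, hc, hsb⟩ := small_ball d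
  have hl2 : 0 < Real.log 2 := Real.log_pos (by norm_num)
  have hmin : 0 < min c 1 := lt_min hc one_pos
  refine ⟨min c 1 * Real.log 2 ^ ((d : ℝ) / 2), by positivity, ?_⟩
  intro n f hf s hs hs2
  obtain ⟨p, hp, hfp⟩ := hf
  have hfun : f = pe p := funext hfp
  subst hfun
  rw [stdGaussian_eq]
  change _ ≤ gam n _
  set m := ∫ y, pe p y ∂(gam n) with hm
  set q := p - MvPolynomial.C m with hq
  have hqx : ∀ x, pe p x - m = pe q x := fun x => by simp [hq, pe]
  have hqd : q.totalDegree ≤ d := (MvPolynomial.totalDegree_sub_C_le _ _).trans hp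
  have hqm : ∫ x, pe q x ∂(gam n) = 0 := by
    simp_rw [← hqx]
    rw [integral_sub (pe_int p) (integrable_const m)]
    simp [hm]
  simp_rw [hqx]
  have hlog : Real.log 2 ≤ |Real.log s| := by
    have h1 : Real.log s ≤ Real.log (1 / 2) := Real.log_le_log hs hs2
    rw [one_div, Real.log_inv] at h1
    rw [abs_of_nonpos (by linarith)]
    linarith
  have hL : min c 1 * Real.log 2 ^ ((d : ℝ) / 2) * s * |Real.log s| ^ (-(d : ℝ) / 2) ≤ min c 1 * s := by
    have h1 : |Real.log s| ^ (-(d : ℝ) / 2) ≤ Real.log 2 ^ (-(d : ℝ) / 2) := by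
      apply Real.rpow_le_rpow_of_nonpos hl2 hlog
      have : (0:ℝ) ≤ d := by positivity
      linarith
    calc _ ≤ min c 1 * Real.log 2 ^ ((d : ℝ) / 2) * s * Real.log 2 ^ (-(d : ℝ) / 2) := by gcongr
      _ = min c 1 * s * (Real.log 2 ^ ((d : ℝ) / 2) * Real.log 2 ^ (-(d : ℝ) / 2)) := by ring
      _ = min c 1 * s := by
        rw [← Real.rpow_add hl2]
        have : (d : ℝ) / 2 + -(d : ℝ) / 2 = 0 := by ring
        rw [this, Real.rpow_zero, mul_one]
  refine (ENNReal.ofReal_le_ofReal hL).trans ?_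
  rcases (integral_nonneg (fun x => sq_nonneg (pe q x)) : 0 ≤ ∫ x, pe q x ^ 2 ∂(gam n)).eq_or_lt with h0 | h0
  · have hae : ∀ᵐ x ∂(gam n), pe q x ^ 2 = 0 :=
      (integral_eq_zero_iff_of_nonneg (fun x => sq_nonneg (pe q x)) (pe_sq_int q)).1 h0.symm
    have h1 : ∀ᵐ x ∂(gam n), |pe q x| ≤ Real.sqrt (∫ y, pe q y ^ 2 ∂(gam n)) * s := by
      filter_upwards [hae] with x hx
      rw [pow_eq_zero_iff (by norm_num)] at hx
      rw [hx, abs_zero]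
      positivity
    have h2 : gam n {x | |pe q x| ≤ Real.sqrt (∫ y, pe q y ^ 2 ∂(gam n)) * s} = 1 :=
      (prob_compl_eq_zero_iff ((isClosed_le (pe_cont q).abs continuous_const).measurableSet)).1 h1
    rw [h2]
    have : min c 1 * s ≤ 1 := by
      have := min_le_right c 1
      nlinarith
    simpa using this
  · refine le_trans ?_ (hsb n q hqd hqm h0 s hs hs2)
    apply ENNReal.ofReal_le_ofReal
    exact mul_le_mul_of_nonneg_right (min_le_left c 1) hs.le
end

section
/- There exists an absolute constant c > 0 such that for every s ≥ 0, every ε > 0, and every polynomial f of degree at most two on the real line, one has ε · (∫_0^s e^{−t} 1_{{f ≤ −ε}}(t) dt) · (∫_0^s e^{−t} 1_{{f ≥ ε}}(t) dt) ≤ c · (∫_0^s e^{−t} 1_{{|f| < ε}}(t) dt) · (∫_0^s e^{−t} |f(t)| dt). -/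
open MeasureTheory

namespace QEL

/-- a crossing interval between a point below `-ε` and a later point above `ε`. -/
lemma crossing (q : ℝ → ℝ) (hq : Continuous q) (ε x y : ℝ) (hε : 0 < ε) (hxy : x ≤ y)
    (hx : q x ≤ -ε) (hy : ε ≤ q y) :
    ∃ a b, x ≤ a ∧ a < b ∧ b ≤ y ∧ q a = -ε ∧ q b = ε ∧ ∀ t ∈ Set.Ioo a b, |q t| < ε := by
  have hK : IsCompact (Set.Icc x y ∩ {t | ε ≤ q t}) :=
    isCompact_Icc.inter_right (isClosed_le continuous_const hq)
  obtain ⟨b, ⟨⟨hxb, hby⟩, hb⟩, hbmin⟩ := hK.exists_isLeast ⟨y, ⟨hxy, le_rfl⟩, hy⟩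
  have hK2 : IsCompact (Set.Icc x b ∩ {t | q t ≤ -ε}) :=
    isCompact_Icc.inter_right (isClosed_le hq continuous_const)
  obtain ⟨a, ⟨⟨hxa, hab⟩, ha⟩, hamax⟩ := hK2.exists_isGreatest ⟨x, ⟨le_rfl, hxb⟩, hx⟩
  simp only [Set.mem_ofPred_eq] at ha hb
  have hab' : a < b := by
    rcases hab.lt_or_eq with h | h
    · exact h
    · subst h; linarith
  have hmid : ∀ t ∈ Set.Ioo a b, |q t| < ε := by
    intro t ht
    rw [abs_lt]
    constructor
    · by_contra! h
      have := hamax ⟨⟨hxa.trans ht.1.le, ht.2.le⟩, h⟩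
      linarith [ht.1]
    · by_contra! h
      have := hbmin ⟨⟨hxa.trans ht.1.le, ht.2.le.trans hby⟩, h⟩
      linarith [ht.2]
  have hcl : ∀ t ∈ Set.Icc a b, |q t| ≤ ε := by
    intro t ht
    have h1 : closure (Set.Ioo a b) ⊆ {t | |q t| ≤ ε} :=
      closure_minimal (fun t ht => (hmid t ht).le) (isClosed_le hq.abs continuous_const)
    rw [closure_Ioo hab'.ne] at h1
    exact h1 ht
  have h1 := abs_le.1 (hcl a ⟨le_rfl, hab'.le⟩)
  have h2 := abs_le.1 (hcl b ⟨hab'.le, le_rfl⟩)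
  exact ⟨a, b, hxa, hab', hby, le_antisymm ha h1.1, le_antisymm h2.2 hb, hmid⟩

lemma ind_int (M : Set ℝ) (hM : MeasurableSet M) (w : ℝ → ℝ) (hw : Continuous w) (a b : ℝ) :
    IntervalIntegrable (fun t => w t * Set.indicator M (fun _ => (1:ℝ)) t) volume a b := by
  have h : (fun t => w t * Set.indicator M (fun _ => (1:ℝ)) t) = Set.indicator M w := by
    funext t; by_cases h : t ∈ M <;> simp [h]
  rw [h]
  have := hw.intervalIntegrable (μ := volume) a b
  exact ⟨this.1.indicator hM, this.2.indicator hM⟩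

lemma ind_int1 (M : Set ℝ) (hM : MeasurableSet M) (a b : ℝ) :
    IntervalIntegrable (fun t => Set.indicator M (fun _ => (1:ℝ)) t) volume a b := by
  simpa using ind_int M hM (fun _ => 1) continuous_const a b

lemma ind_nonneg (M : Set ℝ) (t : ℝ) : 0 ≤ Set.indicator M (fun _ => (1:ℝ)) t :=
  Set.indicator_nonneg (fun _ _ => zero_le_one) t

lemma ind_le (M : Set ℝ) (t : ℝ) : Set.indicator M (fun _ => (1:ℝ)) t ≤ 1 :=
  Set.indicator_le_self' (fun _ _ => zero_le_one) t

lemma exp_int (a b : ℝ) : ∫ t in a..b, Real.exp (-t) = Real.exp (-a) - Real.exp (-b) := by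
  rw [intervalIntegral.integral_comp_neg (fun t => Real.exp t), integral_exp]

lemma tail_le (t s : ℝ) (ht : 0 ≤ t) :
    Real.exp (-t) - Real.exp (-s) ≤ min 1 s * Real.exp (-t) := by
  have h0 := Real.exp_pos (-t)
  have h1 := Real.exp_pos (-s)
  rcases min_choice 1 s with h | h <;> rw [h]
  · linarith
  · have h2 : Real.exp (-s) = Real.exp (-t) * Real.exp (-(s-t)) := by
      rw [← Real.exp_add]; congr 1; ring
    have h3 := Real.add_one_le_exp (-(s-t))
    rw [h2]
    nlinarith

lemma mu_le (S : Set ℝ) (hS : MeasurableSet S) (s : ℝ) (hs : 0 ≤ s) :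
    ∫ t in (0:ℝ)..s, Real.exp (-t) * Set.indicator S (fun _ => (1:ℝ)) t ≤ min 1 s := by
  have h : ∫ t in (0:ℝ)..s, Real.exp (-t) * Set.indicator S (fun _ => (1:ℝ)) t
      ≤ ∫ t in (0:ℝ)..s, Real.exp (-t) := by
    apply intervalIntegral.integral_mono_on hs (ind_int S hS _ (by fun_prop) _ _)
      ((by fun_prop : Continuous fun t : ℝ => Real.exp (-t)).intervalIntegrable _ _)
    intro t _
    have := ind_le S t
    have := Real.exp_pos (-t)
    nlinarith
  rw [exp_int] at h
  have := tail_le 0 s le_rfl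
  simp at *
  constructor <;> linarith

lemma mu_nonneg (S : Set ℝ) (s : ℝ) (hs : 0 ≤ s) :
    0 ≤ ∫ t in (0:ℝ)..s, Real.exp (-t) * Set.indicator S (fun _ => (1:ℝ)) t :=
  intervalIntegral.integral_nonneg hs
    fun t _ => mul_nonneg (Real.exp_pos _).le (ind_nonneg S t)

lemma F_cont (M : Set ℝ) (hM : MeasurableSet M) :
    Continuous fun x => ∫ t in (0:ℝ)..x, Set.indicator M (fun _ => (1:ℝ)) t :=
  intervalIntegral.continuous_primitive (fun a b => ind_int1 M hM a b) 0

lemma fub (M : Set ℝ) (hM : MeasurableSet M) (s : ℝ) (hs : 0 ≤ s) :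
    ∫ x in (0:ℝ)..s, Real.exp (-x) * (∫ t in (0:ℝ)..x, Set.indicator M (fun _ => (1:ℝ)) t)
      ≤ min 1 s * ∫ t in (0:ℝ)..s, Real.exp (-t) * Set.indicator M (fun _ => (1:ℝ)) t := by
  set μ := (volume : Measure ℝ).restrict (Set.Ioc 0 s) with hμ
  set g : ℝ → ℝ → ℝ := fun x t =>
    Real.exp (-x) * (Set.indicator M (fun _ => (1:ℝ)) t *
      Set.indicator {p : ℝ × ℝ | p.2 ≤ p.1} (fun _ => (1:ℝ)) (x, t)) with hg
  have hT : MeasurableSet {p : ℝ × ℝ | p.2 ≤ p.1} := measurableSet_le measurable_snd measurable_fst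
  have hgm : Measurable (Function.uncurry g) := by
    have h1 : Measurable fun p : ℝ × ℝ => Real.exp (-p.1) := by fun_prop
    have h2 : Measurable fun p : ℝ × ℝ => Set.indicator M (fun _ => (1:ℝ)) p.2 :=
      (measurable_const.indicator hM).comp measurable_snd
    have h3 : Measurable fun p : ℝ × ℝ =>
      Set.indicator {p : ℝ × ℝ | p.2 ≤ p.1} (fun _ => (1:ℝ)) p := measurable_const.indicator hT
    exact h1.mul (h2.mul h3)
  have hgi : Integrable (Function.uncurry g) (μ.prod μ) := by
    refine Integrable.of_bound hgm.aestronglyMeasurable 1 ?_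
    rw [hμ, Measure.prod_restrict]
    filter_upwards [ae_restrict_mem (measurableSet_Ioc.prod measurableSet_Ioc)] with p hp
    have hp1 : 0 < p.1 := hp.1.1
    have e1 : Real.exp (-p.1) ≤ 1 := Real.exp_le_one_iff.2 (by linarith)
    have e0 := Real.exp_pos (-p.1)
    have i1 := ind_le M p.2
    have i0 := ind_nonneg M p.2
    have j1 : Set.indicator {p : ℝ × ℝ | p.2 ≤ p.1} (fun _ => (1:ℝ)) p ≤ 1 :=
      Set.indicator_le_self' (fun _ _ => zero_le_one) p
    have j0 : 0 ≤ Set.indicator {p : ℝ × ℝ | p.2 ≤ p.1} (fun _ => (1:ℝ)) p :=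
      Set.indicator_nonneg (fun _ _ => zero_le_one) p
    have hn : 0 ≤ Function.uncurry g p := mul_nonneg e0.le (mul_nonneg i0 j0)
    rw [Real.norm_of_nonneg hn]
    exact mul_le_one₀ e1 (mul_nonneg i0 j0) (mul_le_one₀ i1 j0 j1)
  have hsw := integral_integral_swap hgi
  have hL : ∫ x in (0:ℝ)..s, Real.exp (-x) *
      (∫ t in (0:ℝ)..x, Set.indicator M (fun _ => (1:ℝ)) t) = ∫ x, ∫ t, g x t ∂μ ∂μ := by
    rw [intervalIntegral.integral_of_le hs]
    apply setIntegral_congr_fun measurableSet_Ioc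
    intro x hx
    simp only [hg]
    rw [integral_const_mul]
    congr 1
    rw [intervalIntegral.integral_of_le hx.1.le]
    have : (fun t => Set.indicator M (fun _ => (1:ℝ)) t *
        Set.indicator {p : ℝ × ℝ | p.2 ≤ p.1} (fun _ => (1:ℝ)) (x, t)) =
        Set.indicator (Set.Iic x) (fun t => Set.indicator M (fun _ => (1:ℝ)) t) := by
      funext t
      by_cases h : t ≤ x <;> simp [Set.indicator, h]
    rw [this, integral_indicator measurableSet_Iic, hμ,
      Measure.restrict_restrict measurableSet_Iic]
    congr 2
    ext t
    simp only [Set.mem_Ioc, Set.mem_inter_iff, Set.mem_Iic]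
    have := hx.2
    constructor
    · rintro ⟨h1, h2⟩; exact ⟨h2, h1, h2.trans this⟩
    · rintro ⟨h1, h2, h3⟩; exact ⟨h2, h1⟩
  rw [hL, hsw, ← intervalIntegral.integral_const_mul, intervalIntegral.integral_of_le hs]
  have hinn : ∀ t ∈ Set.Ioc 0 s, ∫ x, g x t ∂μ =
      Set.indicator M (fun _ => (1:ℝ)) t * (Real.exp (-t) - Real.exp (-s)) := by
    intro t ht
    have : (fun x => g x t) = fun x => Set.indicator M (fun _ => (1:ℝ)) t *
        Set.indicator (Set.Ici t) (fun x => Real.exp (-x)) x := by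
      funext x
      by_cases h : t ≤ x <;> simp [hg, Set.indicator, h]
    rw [this, integral_const_mul, integral_indicator measurableSet_Ici, hμ,
      Measure.restrict_restrict measurableSet_Ici, ← exp_int,
      intervalIntegral.integral_of_le ht.2, ← integral_Icc_eq_integral_Ioc]
    congr 3
    ext x
    simp only [Set.mem_Ioc, Set.mem_inter_iff, Set.mem_Ici, Set.mem_Icc]
    constructor
    · rintro ⟨h1, h2, h3⟩; exact ⟨h1, h3⟩
    · rintro ⟨h1, h2⟩; exact ⟨h1, ht.1.trans_le h1, h2⟩
  apply setIntegral_mono_on hgi.integral_prod_right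
    (((ind_int M hM (fun t => Real.exp (-t)) (by fun_prop) 0 s).const_mul _).1) measurableSet_Ioc
  intro t ht
  change ∫ x, g x t ∂μ ≤ _
  rw [hinn t ht]
  have := tail_le t s ht.1.le
  have := ind_nonneg M t
  nlinarith

/-- Markov type bound for a set on which the primitive is at least `ε / D`. -/
lemma cheb (M S : Set ℝ) (hM : MeasurableSet M) (hS : MeasurableSet S) (s ε D : ℝ) (hs : 0 ≤ s)
    (hD : 0 ≤ D)
    (h : ∀ x ∈ S, 0 ≤ x → x ≤ s →
      ε ≤ D * ∫ t in (0:ℝ)..x, Set.indicator M (fun _ => (1:ℝ)) t) :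
    ε * (∫ t in (0:ℝ)..s, Real.exp (-t) * Set.indicator S (fun _ => (1:ℝ)) t) ≤
      D * (min 1 s * ∫ t in (0:ℝ)..s, Real.exp (-t) * Set.indicator M (fun _ => (1:ℝ)) t) := by
  refine le_trans ?_ (mul_le_mul_of_nonneg_left (fub M hM s hs) hD)
  rw [← intervalIntegral.integral_const_mul, ← intervalIntegral.integral_const_mul]
  apply intervalIntegral.integral_mono_on hs
    ((ind_int S hS _ (by fun_prop) _ _).const_mul _)
  · have := F_cont M hM
    exact Continuous.intervalIntegrable (by fun_prop) _ _
  intro x hx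
  have e0 := Real.exp_pos (-x)
  have hF : 0 ≤ ∫ t in (0:ℝ)..x, Set.indicator M (fun _ => (1:ℝ)) t :=
    intervalIntegral.integral_nonneg hx.1 fun t _ => ind_nonneg M t
  by_cases hxS : x ∈ S
  · have := h x hxS hx.1 hx.2
    simp only [Set.indicator_of_mem hxS]
    nlinarith
  · simp only [Set.indicator_of_notMem hxS]
    have := mul_nonneg hD (mul_nonneg e0.le hF)
    simpa using this

/-- separation of values of the primitive. -/
lemma sep (q q' : ℝ → ℝ) (hq : ∀ t, HasDerivAt q (q' t) t) (ε s D x y : ℝ) (hε : 0 < ε)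
    (hD : 0 ≤ D) (hb : ∀ t, 0 ≤ t → t ≤ s → |q t| < ε → |q' t| ≤ D)
    (hx0 : 0 ≤ x) (hxy : x ≤ y) (hys : y ≤ s) (hx : q x ≤ -ε) (hy : ε ≤ q y) :
    2 * ε ≤ D * ∫ t in (0:ℝ)..y, Set.indicator {u | |q u| < ε} (fun _ => (1:ℝ)) t := by
  have hc : Continuous q := continuous_iff_continuousAt.2 fun t => (hq t).continuousAt
  have hM : MeasurableSet {u | |q u| < ε} := (isOpen_lt hc.abs continuous_const).measurableSet
  obtain ⟨a, b, hxa, hab, hby, ha, hb', hmid⟩ := crossing q hc ε x y hε hxy hx hy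
  obtain ⟨ξ, hξ, hslope⟩ := exists_hasDerivAt_eq_slope q q' hab hc.continuousOn
    (fun t _ => hq t)
  have h1 := hb ξ (by linarith [hξ.1]) (by linarith [hξ.2]) (hmid ξ hξ)
  have h2 : 2 * ε ≤ D * (b - a) := by
    rw [eq_div_iff (by linarith), ha, hb'] at hslope
    have := le_abs_self (q' ξ)
    nlinarith
  refine h2.trans (mul_le_mul_of_nonneg_left ?_ hD)
  have h3 : ∫ t in a..b, Set.indicator {u | |q u| < ε} (fun _ => (1:ℝ)) t = b - a := by
    have : ∫ t in a..b, Set.indicator {u | |q u| < ε} (fun _ => (1:ℝ)) t = ∫ t in a..b, (1:ℝ) := by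
      rw [intervalIntegral.integral_of_le hab.le, intervalIntegral.integral_of_le hab.le,
        integral_Ioc_eq_integral_Ioo, integral_Ioc_eq_integral_Ioo]
      apply setIntegral_congr_fun measurableSet_Ioo
      intro t ht
      exact Set.indicator_of_mem (show t ∈ {u | |q u| < ε} from hmid t ht) _
    rw [this]; simp
  rw [← h3]
  apply intervalIntegral.integral_mono_interval (by linarith) hab.le hby
  · exact Filter.Eventually.of_forall fun t => ind_nonneg _ t
  · exact ind_int1 _ hM _ _

lemma N_bound (a b c L : ℝ) (hL : 0 < L) (p0 p1 p2 K : ℝ)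
    (hP : ∀ u, 0 ≤ u → u ≤ 1 → |p0 + p1 * u + p2 * u^2| ≤ K) :
    |L * (c * (p0 + p1/2 + p2/3) + b * L * (p0/2 + p1/3 + p2/4)
      + a * L^2 * (p0/3 + p1/4 + p2/5))| ≤ K * ∫ t in (0:ℝ)..L, |a*t^2+b*t+c| := by
  have h1 : ∫ t in (0:ℝ)..L, (a*t^2+b*t+c) * (p0 + p1 * (t/L) + p2 * (t/L)^2) =
      L * (c * (p0 + p1/2 + p2/3) + b * L * (p0/2 + p1/3 + p2/4)
      + a * L^2 * (p0/3 + p1/4 + p2/5)) := by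
    have hd : ∀ t ∈ Set.uIcc 0 L, HasDerivAt (fun t : ℝ =>
        c*p0*t + (b*p0 + c*p1/L) * t^2/2 + (a*p0 + b*p1/L + c*p2/L^2) * t^3/3
        + (a*p1/L + b*p2/L^2) * t^4/4 + a*p2/L^2 * t^5/5)
        ((a*t^2+b*t+c) * (p0 + p1 * (t/L) + p2 * (t/L)^2)) t := by
      intro t _
      have h := (((((hasDerivAt_id t).const_mul (c*p0)).add
        (((hasDerivAt_pow 2 t).const_mul (b*p0 + c*p1/L)).div_const 2)).add
        (((hasDerivAt_pow 3 t).const_mul (a*p0 + b*p1/L + c*p2/L^2)).div_const 3)).add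
        (((hasDerivAt_pow 4 t).const_mul (a*p1/L + b*p2/L^2)).div_const 4)).add
        (((hasDerivAt_pow 5 t).const_mul (a*p2/L^2)).div_const 5)
      refine h.congr_deriv ?_
      norm_num
      field_simp
      ring
    rw [intervalIntegral.integral_eq_sub_of_hasDerivAt hd
      (Continuous.intervalIntegrable (by fun_prop) _ _)]
    field_simp
    ring
  rw [← h1, ← intervalIntegral.integral_const_mul]
  refine (intervalIntegral.abs_integral_le_integral_abs hL.le).trans ?_
  apply intervalIntegral.integral_mono_on hL.le
    (Continuous.intervalIntegrable (by fun_prop) _ _)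
    (Continuous.intervalIntegrable (by fun_prop) _ _)
  intro t ht
  rw [abs_mul, mul_comm]
  exact mul_le_mul_of_nonneg_right (hP _ (div_nonneg ht.1 hL.le) ((div_le_one hL).2 ht.2))
    (abs_nonneg _)

lemma disc_bound (a b c L : ℝ) (hL : 0 < L) :
    (b^2 - 4*a*c) * L^4 ≤ 2376 * (∫ t in (0:ℝ)..L, |a*t^2+b*t+c|)^2 := by
  have hc := N_bound a b c L hL 9 (-36) 30 9 (by
    intro u h0 h1; rw [abs_le]; constructor <;> nlinarith [sq_nonneg (u - 3/5)])
  have hb := N_bound a b c L hL (-36) 192 (-180) 36 (by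
    intro u h0 h1; rw [abs_le]; constructor <;> nlinarith [sq_nonneg (u - 8/15)])
  have ha := N_bound a b c L hL 30 (-180) 180 30 (by
    intro u h0 h1; rw [abs_le]; constructor <;> nlinarith [sq_nonneg (u - 1/2)])
  set N := ∫ t in (0:ℝ)..L, |a*t^2+b*t+c|
  have hN : 0 ≤ N := by
    have := abs_nonneg (L * (c * (30 + -180/2 + 180/3) + b * L * (30/2 + -180/3 + 180/4)
      + a * L^2 * (30/3 + -180/4 + 180/5)))
    linarith
  have ec : |L * c| ≤ 9 * N := by convert hc using 2; ring
  have eb : |b * L^2| ≤ 36 * N := by convert hb using 2; ring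
  have ea : |a * L^3| ≤ 30 * N := by convert ha using 2; ring
  have k1 : (b * L^2)^2 ≤ (36*N)^2 := sq_le_sq' (by linarith [(abs_le.1 eb).1]) (abs_le.1 eb).2
  have k2 : |(a * L^3) * (L * c)| ≤ (30*N)*(9*N) := by
    rw [abs_mul]; exact mul_le_mul ea ec (abs_nonneg _) (by linarith)
  have k3 := (abs_le.1 k2).1
  nlinarith

lemma J_bound (a b c s : ℝ) (hs : 0 < s) :
    (∫ t in (0:ℝ)..(min 1 s), |a*t^2+b*t+c|) ≤
      3 * ∫ t in (0:ℝ)..s, Real.exp (-t) * |a*t^2+b*t+c| := by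
  have hL : 0 < min 1 s := lt_min one_pos hs
  have h1 : (∫ t in (0:ℝ)..(min 1 s), |a*t^2+b*t+c|) ≤
      ∫ t in (0:ℝ)..(min 1 s), 3 * (Real.exp (-t) * |a*t^2+b*t+c|) := by
    apply intervalIntegral.integral_mono_on hL.le
      (Continuous.intervalIntegrable (by fun_prop) _ _)
      (Continuous.intervalIntegrable (by fun_prop) _ _)
    intro t ht
    have ht1 : t ≤ 1 := ht.2.trans (min_le_left _ _)
    have h3 : 1 ≤ 3 * Real.exp (-t) := by
      rw [Real.exp_neg]
      have : Real.exp t ≤ 3 := (Real.exp_le_exp.2 ht1).trans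
        (by have := Real.exp_one_lt_d9; linarith)
      have h0 := Real.exp_pos t
      rw [← div_eq_mul_inv, le_div_iff₀ h0]; linarith
    have := abs_nonneg (a*t^2+b*t+c)
    nlinarith
  rw [intervalIntegral.integral_const_mul] at h1
  refine h1.trans ?_
  apply mul_le_mul_of_nonneg_left _ (by norm_num)
  apply intervalIntegral.integral_mono_interval le_rfl hL.le (min_le_right _ _)
  · exact Filter.Eventually.of_forall fun t => mul_nonneg (Real.exp_pos _).le (abs_nonneg _)
  · exact Continuous.intervalIntegrable (by fun_prop) _ _

lemma main (a b c s ε : ℝ) (hs : 0 < s) (hε : 0 < ε) (q : ℝ → ℝ)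
    (hqe : ∀ t, q t = a*t^2+b*t+c) :
    ε * (∫ t in (0:ℝ)..s, Real.exp (-t) * Set.indicator {u | q u ≤ -ε} (fun _ => (1:ℝ)) t) *
        (∫ t in (0:ℝ)..s, Real.exp (-t) * Set.indicator {u | ε ≤ q u} (fun _ => (1:ℝ)) t) ≤
      210 * (∫ t in (0:ℝ)..s, Real.exp (-t) * Set.indicator {u | |q u| < ε} (fun _ => (1:ℝ)) t) *
        (∫ t in (0:ℝ)..s, Real.exp (-t) * |q t|) := by
  have hqd : ∀ t, HasDerivAt q (2*a*t+b) t := by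
    intro t
    have h := (((hasDerivAt_pow 2 t).const_mul a).add ((hasDerivAt_id t).const_mul b)).add_const c
    have e : q = fun t => a*t^2+b*t+c := funext hqe
    rw [e]
    refine h.congr_deriv ?_
    norm_num; ring
  have hqc : Continuous q := continuous_iff_continuousAt.2 fun t => (hqd t).continuousAt
  have hM : MeasurableSet {u | |q u| < ε} := (isOpen_lt hqc.abs continuous_const).measurableSet
  have hA : MeasurableSet {u | q u ≤ -ε} := (isClosed_le hqc continuous_const).measurableSet
  have hB : MeasurableSet {u | ε ≤ q u} := (isClosed_le continuous_const hqc).measurableSet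
  have mA := mu_le _ hA s hs.le
  have mB := mu_le _ hB s hs.le
  have nA := mu_nonneg {u | q u ≤ -ε} s hs.le
  have nB := mu_nonneg {u | ε ≤ q u} s hs.le
  have nM := mu_nonneg {u | |q u| < ε} s hs.le
  have hL : 0 < min 1 s := lt_min one_pos hs
  have hJ := J_bound a b c s hs
  have hΔ := disc_bound a b c (min 1 s) hL
  simp_rw [← hqe] at hJ hΔ
  have nN : 0 ≤ ∫ t in (0:ℝ)..(min 1 s), |q t| :=
    intervalIntegral.integral_nonneg hL.le fun t _ => abs_nonneg _
  set J := ∫ t in (0:ℝ)..s, Real.exp (-t) * |q t|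
  set N := ∫ t in (0:ℝ)..(min 1 s), |q t|
  set L := min 1 s
  set μA := ∫ t in (0:ℝ)..s, Real.exp (-t) * Set.indicator {u | q u ≤ -ε} (fun _ => (1:ℝ)) t
    with hμA
  set μB := ∫ t in (0:ℝ)..s, Real.exp (-t) * Set.indicator {u | ε ≤ q u} (fun _ => (1:ℝ)) t
    with hμB
  set μM := ∫ t in (0:ℝ)..s, Real.exp (-t) * Set.indicator {u | |q u| < ε} (fun _ => (1:ℝ)) t
  have nJ : 0 ≤ J := by linarith
  have triv : ∀ S : Set ℝ, (∀ x, 0 ≤ x → x ≤ s → x ∉ S) →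
      ∫ t in (0:ℝ)..s, Real.exp (-t) * Set.indicator S (fun _ => (1:ℝ)) t = 0 := by
    intro S h
    rw [intervalIntegral.integral_congr (g := fun _ => 0)]
    · simp
    · intro t ht
      rw [Set.uIcc_of_le hs.le] at ht
      simp [h t ht.1 ht.2]
  have rn : 0 ≤ 210 * μM * J := by positivity
  by_cases eA : ∀ x, 0 ≤ x → x ≤ s → x ∉ {u | q u ≤ -ε}
  · rw [hμA, triv _ eA]; simpa using rn
  by_cases eB : ∀ x, 0 ≤ x → x ≤ s → x ∉ {u | ε ≤ q u}
  · rw [hμB, triv _ eB]; simpa using rn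
  push Not at eA eB
  obtain ⟨xA, -, -, hxA⟩ := eA
  obtain ⟨xB, -, -, hxB⟩ := eB
  simp only [Set.mem_ofPred_eq] at hxA hxB
  have hid : ∀ t, (2*a*t+b)^2 = 4*a*q t + (b^2-4*a*c) := by intro t; rw [hqe]; ring
  have hdisc : 4 * |a| * ε ≤ b^2-4*a*c := by
    rcases abs_cases a with ⟨h, h'⟩ | ⟨h, h'⟩ <;> rw [h]
    · nlinarith [hid xA, sq_nonneg (2*a*xA+b)]
    · nlinarith [hid xB, sq_nonneg (2*a*xB+b)]
  set D := 210 * J / L^2 with hDdef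
  have hD : 0 ≤ D := by positivity
  have hDL : D * L^2 = 210 * J := by rw [hDdef]; field_simp
  have hb : ∀ t, 0 ≤ t → t ≤ s → |q t| < ε → |2*a*t+b| ≤ D := by
    intro t _ _ ht
    have h1 : (2*a*t+b)^2 ≤ 2*(b^2-4*a*c) := by
      have : a * q t ≤ |a| * ε := by
        calc a * q t ≤ |a * q t| := le_abs_self _
          _ = |a| * |q t| := abs_mul _ _
          _ ≤ |a| * ε := mul_le_mul_of_nonneg_left ht.le (abs_nonneg _)
      rw [hid]; linarith
    have h2 : N^2 ≤ (3*J)^2 := pow_le_pow_left₀ nN hJ 2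
    have h3 : ((2*a*t+b) * L^2)^2 ≤ (D * L^2)^2 := by
      rw [hDL]
      have : (2*a*t+b)^2 * L^4 ≤ 2*(b^2-4*a*c) * L^4 :=
        mul_le_mul_of_nonneg_right h1 (by positivity)
      nlinarith [sq_nonneg J]
    have h4 := abs_le_of_sq_le_sq h3 (by positivity)
    have hL2 : 0 < L^2 := by positivity
    rw [abs_mul, abs_of_pos hL2] at h4
    exact le_of_mul_le_mul_right h4 hL2
  have hb' : ∀ t, 0 ≤ t → t ≤ s → |-q t| < ε → |-(2*a*t+b)| ≤ D := by
    intro t h0 h1 h2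
    rw [abs_neg] at h2 ⊢
    exact hb t h0 h1 h2
  have hF : ∀ x, 0 ≤ x → 0 ≤ D * ∫ t in (0:ℝ)..x, Set.indicator {u | |q u| < ε} (fun _ => (1:ℝ)) t :=
    fun x hx => mul_nonneg hD (intervalIntegral.integral_nonneg hx fun t _ => ind_nonneg _ t)
  have hsum : ∀ x y, 0 ≤ x → x ≤ s → 0 ≤ y → y ≤ s → q x ≤ -ε → ε ≤ q y →
      2*ε ≤ (D * ∫ t in (0:ℝ)..x, Set.indicator {u | |q u| < ε} (fun _ => (1:ℝ)) t) +
        D * ∫ t in (0:ℝ)..y, Set.indicator {u | |q u| < ε} (fun _ => (1:ℝ)) t := by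
    intro x y hx0 hxs hy0 hys hx hy
    rcases le_total x y with h | h
    · have := sep q _ hqd ε s D x y hε hD hb hx0 h hys hx hy
      linarith [hF x hx0]
    · have := sep (fun t => -q t) _ (fun t => (hqd t).neg) ε s D y x hε hD hb' hy0 h hxs
        (by linarith) (by linarith)
      simp only [abs_neg] at this
      linarith [hF y hy0]
  have fin : ε * μA * μB ≤ D * L^2 * μM := by
    by_cases hc : ∀ x ∈ {u | q u ≤ -ε}, 0 ≤ x → x ≤ s →
      ε ≤ D * ∫ t in (0:ℝ)..x, Set.indicator {u | |q u| < ε} (fun _ => (1:ℝ)) t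
    · have := cheb _ _ hM hA s ε D hs.le hD hc
      calc ε * μA * μB ≤ (D * (L * μM)) * L := mul_le_mul this mB nB (by positivity)
        _ = _ := by ring
    · push Not at hc
      obtain ⟨x, hx, hx0, hxs, hlt⟩ := hc
      have := cheb _ _ hM hB s ε D hs.le hD (by
        intro y hy hy0 hys
        have := hsum x y hx0 hxs hy0 hys hx hy
        linarith)
      calc ε * μA * μB = (ε * μB) * μA := by ring
        _ ≤ (D * (L * μM)) * L := mul_le_mul this mA nA (by positivity)
        _ = _ := by ring
  rw [hDL] at fin
  linarith

end QEL

/-- Lemma 2.4: there is an absolute constant `c` such that for every `s ≥ 0`, `ε > 0`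
and every polynomial `f` of degree at most two on the real line,
`ε ∫₀ˢ e^{-t} 1_{f ≤ -ε} dt · ∫₀ˢ e^{-t} 1_{f ≥ ε} dt ≤
 c ∫₀ˢ e^{-t} 1_{|f| < ε} dt · ∫₀ˢ e^{-t} |f(t)| dt`. -/
theorem quadratic_exponential_localization :
    ∃ c : ℝ, 0 < c ∧
      ∀ s : ℝ, 0 ≤ s → ∀ ε : ℝ, 0 < ε →
        ∀ f : Polynomial ℝ, f.natDegree ≤ 2 →
          ε * (∫ t in (0:ℝ)..s, Real.exp (-t) *
                Set.indicator {u : ℝ | f.eval u ≤ -ε} (fun _ => (1:ℝ)) t) *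
              (∫ t in (0:ℝ)..s, Real.exp (-t) *
                Set.indicator {u : ℝ | ε ≤ f.eval u} (fun _ => (1:ℝ)) t) ≤
            c * (∫ t in (0:ℝ)..s, Real.exp (-t) *
                Set.indicator {u : ℝ | |f.eval u| < ε} (fun _ => (1:ℝ)) t) *
              (∫ t in (0:ℝ)..s, Real.exp (-t) * |f.eval t|) := by
  refine ⟨210, by norm_num, ?_⟩
  intro s hs ε hε f hf
  rcases hs.lt_or_eq with h | h
  · apply QEL.main (f.coeff 2) (f.coeff 1) (f.coeff 0) s ε h hε (fun t => f.eval t)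
    intro t
    rw [Polynomial.eval_eq_sum_range' (Nat.lt_succ_of_le hf)]
    simp [Finset.sum_range_succ]
    ring
  · subst h
    simp
end

section
/- The inequality of Lemma 2.4 fails for polynomials of degree three: for every constant c > 0 there exist a > 0 and ε > 0 such that, with f(t) = (t + 1)^2 (t − a), one has ε · (∫_0^∞ e^{−t} 1_{{f ≤ −ε}}(t) dt) · (∫_0^∞ e^{−t} 1_{{f ≥ ε}}(t) dt) > c · (∫_0^∞ e^{−t} 1_{{|f| < ε}}(t) dt) · (∫_0^∞ e^{−t} |f(t)| dt). -/
open MeasureTheory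

lemma aux_int : IntegrableOn (fun t : ℝ => Real.exp (-t)) (Set.Ioi 0) :=
  integrableOn_exp_neg_Ioi 0

lemma aux_eq (S : Set ℝ) (hS : MeasurableSet S) :
    (∫ t in Set.Ioi (0:ℝ), Real.exp (-t) * Set.indicator S (fun _ => (1:ℝ)) t)
      = ∫ t in Set.Ioi (0:ℝ) ∩ S, Real.exp (-t) := by
  rw [← setIntegral_indicator hS]
  congr 1
  ext t
  by_cases h : t ∈ S <;> simp [h]

lemma aux_mono (S T : Set ℝ) (hT : MeasurableSet T) (hT0 : T ⊆ Set.Ioi 0) (h : S ⊆ T) :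
    (∫ t in S, Real.exp (-t)) ≤ ∫ t in T, Real.exp (-t) := by
  apply setIntegral_mono_set (aux_int.mono_set hT0)
  · exact Filter.Eventually.of_forall fun t => (Real.exp_pos _).le
  · exact Filter.Eventually.of_forall h

lemma aux_K : IntegrableOn (fun t : ℝ => Real.exp (-t) * (t + 1) ^ 3) (Set.Ioi 0) := by
  have h : ∀ n : ℕ, IntegrableOn (fun t : ℝ => Real.exp (-t) * t ^ n) (Set.Ioi 0) := by
    intro n
    have := Real.GammaIntegral_convergent (s := (n:ℝ) + 1) (by positivity)
    refine this.congr_fun (fun t ht => ?_) measurableSet_Ioi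
    simp
  have h2 := (((h 3).add ((h 2).const_mul 3)).add ((h 1).const_mul 3)).add (h 0)
  refine h2.congr_fun (fun t ht => ?_) measurableSet_Ioi
  simp only [Pi.add_apply]
  ring

lemma aux_low (a t : ℝ) (ha : 2 ≤ a) (h0 : 0 < t) (h1 : t ≤ a - 1 / a) :
    (t + 1) ^ 2 * (t - a) ≤ -a := by
  have ha0 : 0 < a := by linarith
  have e : a * (1 / a) = 1 := by field_simp
  have hp : 0 < 1 / a := by positivity
  have hq : 1 / a ≤ 1 := by rw [div_le_one ha0]; linarith
  have k1 : 0 ≤ (a - t - 1 / a) * t := mul_nonneg (by linarith) h0.le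
  have k2 : t * (1 / a) ≤ a * (1 / a) - (1 / a) * (1 / a) := by nlinarith
  have k3 : 1 ≤ (t + 2) * (a - t) := by
    have : (1 / a) * (a - t) ≤ a - t := by
      have : 0 ≤ a - t := by linarith
      nlinarith
    nlinarith
  nlinarith [mul_nonneg h0.le (sub_nonneg.2 k3)]

lemma aux_high (a t : ℝ) (ha : 2 ≤ a) (h1 : a + 1 / a ≤ t) :
    a ≤ (t + 1) ^ 2 * (t - a) := by
  have ha0 : 0 < a := by linarith
  have hp : 0 < 1 / a := by positivity
  calc a = a ^ 2 * (1 / a) := by field_simp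
    _ ≤ (t + 1) ^ 2 * (t - a) := by
      apply mul_le_mul _ (by linarith) hp.le (by positivity)
      apply pow_le_pow_left₀ ha0.le; linarith

/-- Remark 2.5: the inequality of Lemma 2.4 fails for polynomials of degree three.
For every `c > 0` there are `a > 0` and `ε > 0` such that, with `f(t) = (t+1)²(t-a)`,
`ε ∫₀^∞ e^{-t} 1_{f ≤ -ε} dt · ∫₀^∞ e^{-t} 1_{f ≥ ε} dt >
 c ∫₀^∞ e^{-t} 1_{|f| < ε} dt · ∫₀^∞ e^{-t} |f(t)| dt`. -/
theorem cubic_counterexample_to_localization :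
    ∀ c : ℝ, 0 < c → ∃ a ε : ℝ, 0 < a ∧ 0 < ε ∧
      c * (∫ t in Set.Ioi (0:ℝ), Real.exp (-t) *
            Set.indicator {u : ℝ | |(u + 1) ^ 2 * (u - a)| < ε} (fun _ => (1:ℝ)) t) *
          (∫ t in Set.Ioi (0:ℝ), Real.exp (-t) * |(t + 1) ^ 2 * (t - a)|) <
        ε * (∫ t in Set.Ioi (0:ℝ), Real.exp (-t) *
            Set.indicator {u : ℝ | (u + 1) ^ 2 * (u - a) ≤ -ε} (fun _ => (1:ℝ)) t) *
          (∫ t in Set.Ioi (0:ℝ), Real.exp (-t) *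
            Set.indicator {u : ℝ | ε ≤ (u + 1) ^ 2 * (u - a)} (fun _ => (1:ℝ)) t) := by
  intro c hc
  set K : ℝ := ∫ t in Set.Ioi (0:ℝ), Real.exp (-t) * (t + 1) ^ 3 with hK
  have hK0 : 0 ≤ K := by
    apply setIntegral_nonneg measurableSet_Ioi
    intro t ht
    have : 0 < t := ht
    positivity
  set E := Real.exp 1 with hE
  have hE0 : 0 < E := Real.exp_pos 1
  obtain ⟨a, ha⟩ : ∃ a : ℝ, a = 2 + 2 * E ^ 3 * c * K := ⟨_, rfl⟩
  have hcK : 0 ≤ 2 * E ^ 3 * c * K := by positivity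
  have ha2 : 2 ≤ a := by linarith
  have ha0 : 0 < a := by linarith
  have hp : 0 < 1 / a := by positivity
  have hq : 1 / a ≤ 1 := by rw [div_le_one ha0]; linarith
  have hq2 : 1 / a ≤ 1 / 2 := by apply one_div_le_one_div_of_le <;> linarith
  refine ⟨a, a, ha0, ha0, ?_⟩
  have m1 : MeasurableSet {u : ℝ | |(u + 1) ^ 2 * (u - a)| < a} :=
    measurableSet_lt (by fun_prop) (by fun_prop)
  have m2 : MeasurableSet {u : ℝ | (u + 1) ^ 2 * (u - a) ≤ -a} :=
    measurableSet_le (by fun_prop) (by fun_prop)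
  have m3 : MeasurableSet {u : ℝ | a ≤ (u + 1) ^ 2 * (u - a)} :=
    measurableSet_le (by fun_prop) (by fun_prop)
  rw [aux_eq _ m1, aux_eq _ m2, aux_eq _ m3]
  have b1 : (∫ t in Set.Ioi (0:ℝ) ∩ {u : ℝ | |(u + 1) ^ 2 * (u - a)| < a}, Real.exp (-t))
      ≤ E * Real.exp (-a) * (2 / a) := by
    refine (aux_mono _ (Set.Ioc (a - 1 / a) (a + 1 / a)) measurableSet_Ioc ?_ ?_).trans ?_
    · intro t ht
      have := ht.1
      simp only [Set.mem_Ioi]; linarith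
    · rintro t ⟨h0, h1⟩
      have h0 : 0 < t := h0
      have h2 : |(t + 1) ^ 2 * (t - a)| < a := h1
      have h1 := abs_lt.1 h2
      constructor
      · by_contra h
        have := aux_low a t ha2 h0 (not_lt.1 h)
        linarith
      · by_contra h
        have := aux_high a t ha2 (not_le.1 h).le
        linarith
    · have := norm_setIntegral_le_of_norm_le_const (μ := volume) (C := E * Real.exp (-a))
        (s := Set.Ioc (a - 1 / a) (a + 1 / a)) (f := fun t => Real.exp (-t)) (by simp) (by
          intro t ht
          rw [Real.norm_eq_abs, abs_of_pos (Real.exp_pos _), hE, ← Real.exp_add]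
          apply Real.exp_le_exp.2
          have := ht.1
          linarith)
      refine (le_abs_self _).trans (this.trans (le_of_eq ?_))
      rw [Real.volume_real_Ioc_of_le (by linarith)]
      ring
  have b2 : Real.exp (-1) ≤
      ∫ t in Set.Ioi (0:ℝ) ∩ {u : ℝ | (u + 1) ^ 2 * (u - a) ≤ -a}, Real.exp (-t) := by
    refine le_trans ?_ (aux_mono (Set.Ioc 0 1) _ (measurableSet_Ioi.inter m2)
      Set.inter_subset_left ?_)
    · have := setIntegral_mono_on (μ := volume) (s := Set.Ioc (0:ℝ) 1)
        (f := fun _ => Real.exp (-1)) (g := fun t => Real.exp (-t)) (by simp)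
        (aux_int.mono_set fun t ht => ht.1) measurableSet_Ioc
        (fun t ht => Real.exp_le_exp.2 (by linarith [ht.2]))
      simpa using this
    · rintro t ⟨h0, h1⟩
      exact ⟨h0, aux_low a t ha2 h0 (by linarith)⟩
  have b3 : Real.exp (-(a + 1)) ≤
      ∫ t in Set.Ioi (0:ℝ) ∩ {u : ℝ | a ≤ (u + 1) ^ 2 * (u - a)}, Real.exp (-t) := by
    rw [← integral_exp_neg_Ioi]
    apply aux_mono _ _ (measurableSet_Ioi.inter m3) Set.inter_subset_left
    intro t ht
    have ht : a + 1 < t := ht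
    refine ⟨?_, aux_high a t ha2 (by linarith)⟩
    simp only [Set.mem_Ioi]; linarith
  have b4 : (∫ t in Set.Ioi (0:ℝ), Real.exp (-t) * |(t + 1) ^ 2 * (t - a)|) ≤ a * K := by
    rw [hK, ← integral_const_mul]
    apply integral_mono_of_nonneg
    · exact Filter.Eventually.of_forall fun t => by simp only [Pi.zero_apply]; positivity
    · exact aux_K.const_mul a
    · filter_upwards [ae_restrict_mem measurableSet_Ioi] with t ht
      have ht : 0 < t := ht
      have h1 : |(t + 1) ^ 2 * (t - a)| ≤ a * (t + 1) ^ 3 := by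
        rw [abs_mul, abs_of_nonneg (sq_nonneg (t + 1))]
        have : |t - a| ≤ a * (t + 1) := by
          rw [abs_le]; constructor <;> nlinarith
        nlinarith [mul_le_mul_of_nonneg_left this (sq_nonneg (t + 1))]
      have := mul_le_mul_of_nonneg_left h1 (Real.exp_pos (-t)).le
      linarith
  have n4 : 0 ≤ ∫ t in Set.Ioi (0:ℝ), Real.exp (-t) * |(t + 1) ^ 2 * (t - a)| :=
    integral_nonneg fun t => by simp only [Pi.zero_apply]; positivity
  set X := Real.exp (-a) with hX
  have hX0 : 0 < X := Real.exp_pos _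
  have e1 : Real.exp (-1) = 1 / E := by rw [Real.exp_neg, hE, one_div]
  have e2 : Real.exp (-(a + 1)) = X / E := by
    rw [neg_add, Real.exp_add, e1, hX]; ring
  rw [e1] at b2
  rw [e2] at b3
  calc _ ≤ c * (E * X * (2 / a)) * (a * K) := by gcongr
    _ = (2 * E ^ 3 * c * K) * (X / E ^ 2) := by field_simp
    _ < a * (X / E ^ 2) := by
      apply mul_lt_mul_of_pos_right (by linarith) (by positivity)
    _ = a * (1 / E) * (X / E) := by field_simp
    _ ≤ _ := by gcongr
end

section
/- For every d ≥ 1 and every natural number n there exists a constant c(d, n) > 0, depending only on d and n, such that for every s ≥ 0, every ε > 0, and every polynomial f of degree at most d on the real line, one has ε · (∫_s^{s+1} t^n 1_{{f ≤ −ε}}(t) dt) · (∫_s^{s+1} t^n 1_{{f ≥ ε}}(t) dt) ≤ c(d, n) · (∫_s^{s+1} t^n 1_{{|f| < ε}}(t) dt) · (∫_s^{s+1} t^n |f(t)| dt). -/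
open MeasureTheory

lemma pwl_norm (d n : ℕ) : ∃ m : ℝ, 0 < m ∧ ∀ v : Fin (d+1) → ℝ,
    m * ‖v‖ ≤ ∫ u in (0:ℝ)..1, u ^ n * |∑ i, v i * u ^ (i:ℕ)| := by
  set N : (Fin (d+1) → ℝ) → ℝ := fun v => ∫ u in (0:ℝ)..1, u ^ n * |∑ i, v i * u ^ (i:ℕ)| with hN
  have hcont : Continuous N := by
    apply intervalIntegral.continuous_parametric_intervalIntegral_of_continuous'
    fun_prop
  have hhom : ∀ (r : ℝ) v, N (r • v) = |r| * N v := by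
    intro r v
    simp only [hN]
    rw [← intervalIntegral.integral_const_mul]
    congr 1
    ext u
    have : ∑ i, (r • v) i * u ^ (i:ℕ) = r * ∑ i, v i * u ^ (i:ℕ) := by
      rw [Finset.mul_sum]
      refine Finset.sum_congr rfl fun i _ => ?_
      simp [mul_assoc]
    rw [this, abs_mul]; ring
  have hpos : ∀ v, v ≠ 0 → 0 < N v := by
    intro v hv
    apply intervalIntegral.integral_pos one_pos
    · fun_prop
    · intro u hu
      exact mul_nonneg (pow_nonneg hu.1.le _) (abs_nonneg _)
    · by_contra hcon
      push Not at hcon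
      apply hv
      have hp : (∑ i : Fin (d+1), Polynomial.monomial (i:ℕ) (v i)) = 0 := by
        apply Polynomial.eq_zero_of_infinite_isRoot
        refine (Set.Ioo_infinite (zero_lt_one (α := ℝ))).mono ?_
        intro u hu
        have h1 := hcon u ⟨hu.1.le, hu.2.le⟩
        have h2 : 0 < u ^ n := pow_pos hu.1 _
        have h3 : |∑ i, v i * u ^ (i:ℕ)| ≤ 0 := by
          by_contra h; push Not at h
          exact absurd (mul_pos h2 h) (not_lt.mpr h1)
        have h4 := abs_nonpos_iff.mp h3
        simpa [Polynomial.IsRoot, Polynomial.eval_finset_sum] using h4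
      ext j
      have := congrArg (fun p => Polynomial.coeff p (j:ℕ)) hp
      simpa [Polynomial.finset_sum_coeff, Polynomial.coeff_monomial, Fin.val_inj] using this
  obtain ⟨w, hw, hmin⟩ := (isCompact_sphere (0 : Fin (d+1) → ℝ) 1).exists_isMinOn
    (NormedSpace.sphere_nonempty.mpr zero_le_one) hcont.continuousOn
  have hw1 : ‖w‖ = 1 := by simpa using hw
  refine ⟨N w, hpos w (by rintro rfl; simp at hw1), fun v => ?_⟩
  change N w * ‖v‖ ≤ N v
  by_cases hv : v = 0
  · subst hv
    have := hhom 0 0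
    simp at this
    simp [this]
  · have hv' : 0 < ‖v‖ := norm_pos_iff.mpr hv
    have h1 : N w ≤ N (‖v‖⁻¹ • v) := hmin (by simp [norm_smul, hv'.ne'])
    rw [hhom, abs_of_pos (inv_pos.mpr hv')] at h1
    calc N w * ‖v‖ ≤ (‖v‖⁻¹ * N v) * ‖v‖ := by gcongr
      _ = N v := by field_simp

lemma pwl_markov (d n : ℕ) : ∃ C : ℝ, 0 < C ∧ ∀ g : Polynomial ℝ, g.natDegree ≤ d →
    ∀ x ∈ Set.Icc (0:ℝ) 1, ∀ y ∈ Set.Icc (0:ℝ) 1,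
    |g.eval x - g.eval y| ≤ C * |x - y| * ∫ u in (0:ℝ)..1, u ^ n * |g.eval u| := by
  obtain ⟨m, hm, h⟩ := pwl_norm d n
  refine ⟨m⁻¹ * ((d+1) * (d+1)), by positivity, fun g hg x hx y hy => ?_⟩
  have hev : ∀ u, g.eval u = ∑ i : Fin (d+1), g.coeff i * u ^ (i:ℕ) := by
    intro u
    rw [Polynomial.eval_eq_sum_range' (Nat.lt_succ_of_le hg), Finset.sum_range]
  have hv := h (fun i => g.coeff i)
  simp only [← hev] at hv
  set V := ‖(fun i : Fin (d+1) => g.coeff i)‖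
  set J := ∫ u in (0:ℝ)..1, u ^ n * |g.eval u|
  have hVJ : V ≤ m⁻¹ * J := by
    rw [inv_mul_eq_div, le_div_iff₀ hm]; linarith
  have hV0 : 0 ≤ V := norm_nonneg _
  have hterm : ∀ i : Fin (d+1), |g.coeff i * x ^ (i:ℕ) - g.coeff i * y ^ (i:ℕ)|
      ≤ V * (|x - y| * (d+1)) := by
    intro i
    rw [← mul_sub, abs_mul]
    have h1 : |g.coeff i| ≤ V := norm_le_pi_norm (fun i : Fin (d+1) => g.coeff i) i
    have h2 := abs_pow_sub_pow_le x y (i:ℕ)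
    have h3 : max |x| |y| ≤ 1 := by
      rw [abs_of_nonneg hx.1, abs_of_nonneg hy.1]; exact max_le hx.2 hy.2
    have h4 : max |x| |y| ^ ((i:ℕ) - 1) ≤ 1 := pow_le_one₀ (by positivity) h3
    have h5 : ((i:ℕ):ℝ) ≤ d + 1 := by exact_mod_cast i.2.le
    have h6 : |x ^ (i:ℕ) - y ^ (i:ℕ)| ≤ |x - y| * (d+1) := by
      refine h2.trans ?_
      calc |x - y| * (i:ℕ) * max |x| |y| ^ ((i:ℕ) - 1) ≤ |x - y| * (i:ℕ) * 1 := by gcongr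
        _ ≤ |x - y| * (d+1) := by rw [mul_one]; gcongr
    gcongr
  calc |g.eval x - g.eval y|
      = |∑ i : Fin (d+1), (g.coeff i * x ^ (i:ℕ) - g.coeff i * y ^ (i:ℕ))| := by
        rw [hev, hev, Finset.sum_sub_distrib]
    _ ≤ ∑ i : Fin (d+1), |g.coeff i * x ^ (i:ℕ) - g.coeff i * y ^ (i:ℕ)| :=
        Finset.abs_sum_le_sum_abs _ _
    _ ≤ ∑ i : Fin (d+1), V * (|x - y| * (d+1)) := Finset.sum_le_sum fun i _ => hterm i
    _ = V * (|x - y| * (d+1) * (d+1)) := by simp; ring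
    _ ≤ (m⁻¹ * J) * (|x - y| * (d+1) * (d+1)) := by gcongr
    _ = _ := by ring

lemma pwl_integrable (n : ℕ) (S : Set ℝ) (hS : MeasurableSet S) (a b : ℝ) :
    IntervalIntegrable (fun t : ℝ => t ^ n * Set.indicator S (fun _ => (1:ℝ)) t) volume a b := by
  have : (fun t : ℝ => t ^ n * Set.indicator S (fun _ => (1:ℝ)) t)
      = Set.indicator S (fun t => t ^ n) := by
    ext t
    by_cases h : t ∈ S <;> simp [h]
  rw [this]
  have h := (continuous_pow (M := ℝ) n).intervalIntegrable (μ := volume) a b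
  exact ⟨h.1.indicator hS, h.2.indicator hS⟩

lemma pwl_core (d n : ℕ) (C : ℝ) (hC : 0 < C)
    (hM : ∀ g : Polynomial ℝ, g.natDegree ≤ d →
      ∀ x ∈ Set.Icc (0:ℝ) 1, ∀ y ∈ Set.Icc (0:ℝ) 1,
      |g.eval x - g.eval y| ≤ C * |x - y| * ∫ u in (0:ℝ)..1, u ^ n * |g.eval u|)
    (s : ℝ) (hs : 0 ≤ s) (ε : ℝ) (hε : 0 < ε) (f : Polynomial ℝ) (hf : f.natDegree ≤ d)
    (a : ℝ) (ha : a ∈ Set.Icc s (s+1)) (hfa : f.eval a ≤ -ε)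
    (hlast : ∀ t ∈ Set.Icc s (s+1), f.eval t ≤ -ε → t ≤ a)
    (b' : ℝ) (hb' : b' ∈ Set.Icc s (s+1)) (hab' : a ≤ b') (hfb' : ε ≤ f.eval b') :
    ε * (∫ t in s..(s + 1), t ^ n *
          Set.indicator {u : ℝ | f.eval u ≤ -ε} (fun _ => (1:ℝ)) t) *
        (∫ t in s..(s + 1), t ^ n *
          Set.indicator {u : ℝ | ε ≤ f.eval u} (fun _ => (1:ℝ)) t) ≤
      C * (∫ t in s..(s + 1), t ^ n *
          Set.indicator {u : ℝ | |f.eval u| < ε} (fun _ => (1:ℝ)) t) *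
        (∫ t in s..(s + 1), t ^ n * |f.eval t|) := by
  have hfc : Continuous fun t => f.eval t := f.continuous
  have hs1 : s ≤ s + 1 := by linarith
  have m1 : MeasurableSet {u : ℝ | f.eval u ≤ -ε} := measurableSet_le hfc.measurable measurable_const
  have m2 : MeasurableSet {u : ℝ | ε ≤ f.eval u} := measurableSet_le measurable_const hfc.measurable
  have m3 : MeasurableSet {u : ℝ | |f.eval u| < ε} :=
    measurableSet_lt hfc.abs.measurable measurable_const
  have ha0 : 0 ≤ a := hs.trans ha.1
  -- first point where f ≥ ε after a
  have hcomp : IsCompact (Set.Icc a b' ∩ {u : ℝ | ε ≤ f.eval u}) :=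
    isCompact_Icc.inter_right (isClosed_le continuous_const hfc)
  obtain ⟨b, ⟨⟨hab, hbb'⟩, hfb⟩, hbmin⟩ := hcomp.exists_isLeast ⟨b', ⟨hab', le_rfl⟩, hfb'⟩
  have hfb : ε ≤ f.eval b := hfb
  have hbs : b ≤ s + 1 := hbb'.trans hb'.2
  have hin : ∀ t ∈ Set.Ioo a b, |f.eval t| < ε := by
    intro t ht
    rw [abs_lt]
    constructor
    · by_contra h
      push Not at h
      have := hlast t ⟨ha.1.trans ht.1.le, ht.2.le.trans hbs⟩ h
      linarith [ht.1]
    · by_contra h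
      push Not at h
      have := hbmin ⟨⟨ht.1.le, ht.2.le.trans hbb'⟩, h⟩
      linarith [ht.2]
  have hw0 : ∀ (S : Set ℝ) (t : ℝ), 0 ≤ t →
      0 ≤ t ^ n * Set.indicator S (fun _ => (1:ℝ)) t := fun S t ht =>
    mul_nonneg (pow_nonneg ht _) (Set.indicator_nonneg (fun _ _ => zero_le_one) _)
  have hP : (∫ t in s..(s + 1), t ^ n *
          Set.indicator {u : ℝ | f.eval u ≤ -ε} (fun _ => (1:ℝ)) t) ≤ a ^ n := by
    calc _ ≤ ∫ t in s..(s+1), a ^ n := by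
          refine intervalIntegral.integral_mono_on hs1 (pwl_integrable n _ m1 _ _)
            (by simp) ?_
          intro t ht
          have ht0 : 0 ≤ t := hs.trans ht.1
          by_cases h : f.eval t ≤ -ε
          · have := hlast t ht h
            simp only [Set.indicator, Set.mem_setOf_eq, h, if_true, mul_one]
            gcongr
          · simp only [Set.indicator, Set.mem_setOf_eq, h, if_false, mul_zero]
            positivity
      _ = a ^ n := by simp
  have hQ : (∫ t in s..(s + 1), t ^ n *
          Set.indicator {u : ℝ | ε ≤ f.eval u} (fun _ => (1:ℝ)) t) ≤ (s+1) ^ n := by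
    calc _ ≤ ∫ t in s..(s+1), (s+1) ^ n := by
          refine intervalIntegral.integral_mono_on hs1 (pwl_integrable n _ m2 _ _)
            (by simp) ?_
          intro t ht
          have ht0 : 0 ≤ t := hs.trans ht.1
          by_cases h : ε ≤ f.eval t
          · simp only [Set.indicator, Set.mem_setOf_eq, h, if_true, mul_one]
            exact pow_le_pow_left₀ ht0 ht.2 n
          · simp only [Set.indicator, Set.mem_setOf_eq, h, if_false, mul_zero]
            positivity
      _ = (s+1) ^ n := by simp
  have hQ0 : 0 ≤ (∫ t in s..(s + 1), t ^ n *
          Set.indicator {u : ℝ | ε ≤ f.eval u} (fun _ => (1:ℝ)) t) :=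
    intervalIntegral.integral_nonneg hs1 fun t ht => hw0 _ t (hs.trans ht.1)
  have hR : (b - a) * a ^ n ≤ ∫ t in s..(s + 1), t ^ n *
          Set.indicator {u : ℝ | |f.eval u| < ε} (fun _ => (1:ℝ)) t := by
    calc (b - a) * a ^ n = ∫ t in a..b, a ^ n := by simp
      _ ≤ ∫ t in a..b, t ^ n *
          Set.indicator {u : ℝ | |f.eval u| < ε} (fun _ => (1:ℝ)) t := by
          refine intervalIntegral.integral_mono_on_of_le_Ioo hab (by simp)
            (pwl_integrable n _ m3 _ _) ?_
          intro t ht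
          have h := hin t ht
          simp only [Set.indicator, Set.mem_setOf_eq, h, if_true, mul_one]
          exact pow_le_pow_left₀ ha0 ht.1.le n
      _ ≤ _ := by
          refine intervalIntegral.integral_mono_interval ha.1 hab hbs ?_
            (pwl_integrable n _ m3 _ _)
          filter_upwards [ae_restrict_mem measurableSet_Ioc] with t ht
          exact hw0 _ t (hs.trans ht.1.le)
  set g := f.comp (Polynomial.X + Polynomial.C s) with hg
  have hgd : g.natDegree ≤ d := by
    rw [hg, Polynomial.natDegree_comp]; simpa using hf
  have hge : ∀ u, g.eval u = f.eval (u + s) := by intro u; simp [hg]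
  set J := ∫ u in (0:ℝ)..1, u ^ n * |g.eval u|
  have hJK : (s+1) ^ n * J ≤ ∫ t in s..(s + 1), t ^ n * |f.eval t| := by
    have e := intervalIntegral.integral_comp_add_right (a := 0) (b := 1)
      (fun t => t ^ n * |f.eval t|) s
    rw [zero_add, add_comm 1 s] at e
    rw [← e, ← intervalIntegral.integral_const_mul]
    refine intervalIntegral.integral_mono_on zero_le_one ?_ ?_ ?_
    · apply Continuous.intervalIntegrable
      have := g.continuous
      fun_prop
    · apply Continuous.intervalIntegrable
      fun_prop
    · intro u hu
      rw [hge, ← mul_assoc, ← mul_pow]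
      have h0 := hu.1
      have : (s+1) * u ≤ u + s := by nlinarith [hu.1, hu.2]
      gcongr
  have hdiff : 2 * ε ≤ C * (b - a) * J := by
    have h := hM g hgd (b - s) ⟨by linarith [ha.1], by linarith⟩ (a - s)
      ⟨by linarith [ha.1], by linarith [ha.2]⟩
    rw [hge, hge, sub_add_cancel, sub_add_cancel, sub_sub_sub_cancel_right,
      abs_of_nonneg (sub_nonneg.mpr hab)] at h
    have := (le_abs_self _).trans h
    linarith
  set P := (∫ t in s..(s + 1), t ^ n *
          Set.indicator {u : ℝ | f.eval u ≤ -ε} (fun _ => (1:ℝ)) t)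
  set Q := (∫ t in s..(s + 1), t ^ n *
          Set.indicator {u : ℝ | ε ≤ f.eval u} (fun _ => (1:ℝ)) t)
  set R := ∫ t in s..(s + 1), t ^ n *
          Set.indicator {u : ℝ | |f.eval u| < ε} (fun _ => (1:ℝ)) t
  set K := ∫ t in s..(s + 1), t ^ n * |f.eval t|
  have hK0 : 0 ≤ K := intervalIntegral.integral_nonneg hs1 fun t ht =>
    mul_nonneg (pow_nonneg (hs.trans ht.1) _) (abs_nonneg _)
  have hba : 0 ≤ b - a := sub_nonneg.mpr hab
  have han : 0 ≤ a ^ n := pow_nonneg ha0 n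
  have hsn : 0 ≤ (s+1) ^ n := by positivity
  have hεJ : ε ≤ C * (b - a) * J := by linarith
  calc ε * P * Q ≤ ε * a ^ n * (s+1) ^ n := by gcongr
    _ ≤ (C * (b - a) * J) * a ^ n * (s+1) ^ n := by gcongr
    _ = C * ((b - a) * a ^ n) * ((s+1) ^ n * J) := by ring
    _ ≤ C * ((b - a) * a ^ n) * K := by gcongr
    _ ≤ C * R * K := by gcongr

/-- Lemma 3.1: for every `d ≥ 1` and `n` there is `c(d,n) > 0` such that for every `s ≥ 0`,
`ε > 0` and every polynomial `f` of degree at most `d` on the real line,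
`ε ∫_s^{s+1} tⁿ 1_{f ≤ -ε} dt · ∫_s^{s+1} tⁿ 1_{f ≥ ε} dt ≤
 c(d,n) ∫_s^{s+1} tⁿ 1_{|f| < ε} dt · ∫_s^{s+1} tⁿ |f(t)| dt`. -/
theorem power_weight_localization (d n : ℕ) (hd : 1 ≤ d) :
    ∃ c : ℝ, 0 < c ∧
      ∀ s : ℝ, 0 ≤ s → ∀ ε : ℝ, 0 < ε →
        ∀ f : Polynomial ℝ, f.natDegree ≤ d →
          ε * (∫ t in s..(s + 1), t ^ n *
                Set.indicator {u : ℝ | f.eval u ≤ -ε} (fun _ => (1:ℝ)) t) *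
              (∫ t in s..(s + 1), t ^ n *
                Set.indicator {u : ℝ | ε ≤ f.eval u} (fun _ => (1:ℝ)) t) ≤
            c * (∫ t in s..(s + 1), t ^ n *
                Set.indicator {u : ℝ | |f.eval u| < ε} (fun _ => (1:ℝ)) t) *
              (∫ t in s..(s + 1), t ^ n * |f.eval t|) := by
  obtain ⟨C, hC, hM⟩ := pwl_markov d n
  refine ⟨C, hC, fun s hs ε hε f hf => ?_⟩
  have hfc : Continuous fun t => f.eval t := f.continuous
  have hs1 : s ≤ s + 1 := by linarith
  have hR0 : 0 ≤ C * (∫ t in s..(s + 1), t ^ n *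
                Set.indicator {u : ℝ | |f.eval u| < ε} (fun _ => (1:ℝ)) t) *
              (∫ t in s..(s + 1), t ^ n * |f.eval t|) := by
    refine mul_nonneg (mul_nonneg hC.le ?_) ?_
    · exact intervalIntegral.integral_nonneg hs1 fun t ht =>
        mul_nonneg (pow_nonneg (hs.trans ht.1) _)
          (Set.indicator_nonneg (fun _ _ => zero_le_one) _)
    · exact intervalIntegral.integral_nonneg hs1 fun t ht =>
        mul_nonneg (pow_nonneg (hs.trans ht.1) _) (abs_nonneg _)
  have hzero : ∀ S : Set ℝ, ¬ (Set.Icc s (s+1) ∩ S).Nonempty →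
      (∫ t in s..(s + 1), t ^ n * Set.indicator S (fun _ => (1:ℝ)) t) = 0 := by
    intro S hS
    rw [intervalIntegral.integral_congr (g := fun _ => (0:ℝ))]
    · simp
    · intro t ht
      rw [Set.uIcc_of_le hs1] at ht
      have : t ∉ S := fun h => hS ⟨t, ht, h⟩
      simp [this]
  by_cases h1 : (Set.Icc s (s+1) ∩ {u : ℝ | f.eval u ≤ -ε}).Nonempty
  swap
  · rw [hzero _ h1]; simpa using hR0
  by_cases h2 : (Set.Icc s (s+1) ∩ {u : ℝ | ε ≤ f.eval u}).Nonempty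
  swap
  · rw [hzero _ h2]; simpa using hR0
  obtain ⟨a, ⟨ha, hfa⟩, hamax⟩ :=
    (isCompact_Icc.inter_right (isClosed_le hfc continuous_const)).exists_isGreatest h1
  obtain ⟨b, ⟨hb, hfb⟩, hbmax⟩ :=
    (isCompact_Icc.inter_right (isClosed_le continuous_const hfc)).exists_isGreatest h2
  rcases le_total a b with hab | hab
  · exact pwl_core d n C hC hM s hs ε hε f hf a ha hfa (fun t ht h => hamax ⟨ht, h⟩) b hb hab hfb
  · have hfa : f.eval a ≤ -ε := hfa
    have hfb : ε ≤ f.eval b := hfb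
    have key := pwl_core d n C hC hM s hs ε hε (-f) (by simpa using hf) b hb
      (by simpa using hfb)
      (fun t ht h => hbmax ⟨ht, by simpa using h⟩) a ha hab
      (by rw [Polynomial.eval_neg]; linarith)
    simp only [Polynomial.eval_neg, neg_le_neg_iff, abs_neg, le_neg (a := ε)] at key
    rw [mul_right_comm]
    exact key
end

section
/- Infimum of interval variances with power-law density: for each natural number n, the infimum over s ≥ 0 of the variance σ_s^2 of the probability measure μ_s on [s, s+1] with density proportional to t^n is strictly positive; here σ_s^2 = ∫ t^2 dμ_s − (∫ t dμ_s)^2 and μ_s(dt) = (∫_s^{s+1} t^n dt)^{−1} 1_{[s,s+1]}(t) t^n dt. -/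
open MeasureTheory

/-- For each `n`, the infimum over `s ≥ 0` of the variance of the probability measure on
`[s, s+1]` with density proportional to `tⁿ` is strictly positive: there is a uniform
positive lower bound `c` with
`c ≤ (∫_s^{s+1} t² tⁿ dt)/(∫_s^{s+1} tⁿ dt) - ((∫_s^{s+1} t tⁿ dt)/(∫_s^{s+1} tⁿ dt))²`. -/
theorem variance_power_weight_uniformly_positive (n : ℕ) :
    ∃ c : ℝ, 0 < c ∧
      ∀ s : ℝ, 0 ≤ s →
        c ≤ (∫ t in s..(s + 1), t ^ 2 * t ^ n) / (∫ t in s..(s + 1), t ^ n) -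
            ((∫ t in s..(s + 1), t * t ^ n) / (∫ t in s..(s + 1), t ^ n)) ^ 2 := by
  refine ⟨(1 / 2) ^ n / 96, by positivity, ?_⟩
  intro s hs
  set Z := ∫ t in s..(s + 1), t ^ n with hZ
  set A := ∫ t in s..(s + 1), t * t ^ n with hA
  set B := ∫ t in s..(s + 1), t ^ 2 * t ^ n with hB
  have hii : ∀ (f : ℝ → ℝ), Continuous f → ∀ a b : ℝ, IntervalIntegrable f volume a b :=
    fun f hf a b => hf.intervalIntegrable a b
  have hZpos : 0 < Z := by
    apply intervalIntegral.intervalIntegral_pos_of_pos_on (hii _ (by fun_prop) _ _)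
    · intro t ht
      have : 0 < t := lt_of_le_of_lt hs ht.1
      positivity
    · linarith
  have hZle : Z ≤ (s + 1) ^ n := by
    have h : Z ≤ ∫ t in s..(s + 1), (s + 1) ^ n := by
      apply intervalIntegral.integral_mono_on (by linarith) (hii _ (by fun_prop) _ _)
        (hii _ (by fun_prop) _ _)
      intro t ht
      exact pow_le_pow_left₀ (hs.trans ht.1) ht.2 n
    simpa using h
  have key : ∀ m : ℝ, (1 / 2) ^ n / 96 * Z ≤ B - 2 * m * A + m ^ 2 * Z := by
    intro m
    have e1 : B - 2 * m * A + m ^ 2 * Z = ∫ t in s..(s + 1), (t - m) ^ 2 * t ^ n := by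
      rw [hB, hA, hZ, ← intervalIntegral.integral_const_mul, ← intervalIntegral.integral_const_mul,
        ← intervalIntegral.integral_sub (hii _ (by fun_prop) _ _) (hii _ (by fun_prop) _ _),
        ← intervalIntegral.integral_add (hii _ (by fun_prop) _ _) (hii _ (by fun_prop) _ _)]
      congr 1
      ext t
      ring
    have e2 : (∫ t in s..(s + 1 / 2), (t - m) ^ 2 * t ^ n)
        + (∫ t in (s + 1 / 2)..(s + 1), (t - m) ^ 2 * t ^ n)
        = ∫ t in s..(s + 1), (t - m) ^ 2 * t ^ n :=
      intervalIntegral.integral_add_adjacent_intervals (hii _ (by fun_prop) _ _)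
        (hii _ (by fun_prop) _ _)
    have e3 : 0 ≤ ∫ t in s..(s + 1 / 2), (t - m) ^ 2 * t ^ n := by
      apply intervalIntegral.integral_nonneg (by linarith)
      intro t ht
      have : 0 ≤ t := hs.trans ht.1
      positivity
    have e4 : (∫ t in (s + 1 / 2)..(s + 1), (t - m) ^ 2 * ((s + 1) / 2) ^ n)
        ≤ ∫ t in (s + 1 / 2)..(s + 1), (t - m) ^ 2 * t ^ n := by
      apply intervalIntegral.integral_mono_on (by linarith) (hii _ (by fun_prop) _ _)
        (hii _ (by fun_prop) _ _)
      intro t ht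
      apply mul_le_mul_of_nonneg_left _ (sq_nonneg _)
      exact pow_le_pow_left₀ (by linarith) (by linarith [ht.1]) n
    have e5 : (1 : ℝ) / 96 ≤ ∫ t in (s + 1 / 2)..(s + 1), (t - m) ^ 2 := by
      rw [intervalIntegral.integral_comp_sub_right (fun t => t ^ 2) m, integral_pow]
      norm_num
      nlinarith [sq_nonneg (s + 3 / 4 - m)]
    rw [intervalIntegral.integral_mul_const] at e4
    have e6 : (0 : ℝ) ≤ ((s + 1) / 2) ^ n := by positivity
    have e7 := mul_le_mul_of_nonneg_right e5 e6
    have e8 : (1 / 2 : ℝ) ^ n * Z ≤ ((s + 1) / 2) ^ n := by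
      calc (1 / 2 : ℝ) ^ n * Z ≤ (1 / 2 : ℝ) ^ n * (s + 1) ^ n := by gcongr
        _ = ((s + 1) / 2) ^ n := by rw [← mul_pow]; congr 1; ring
    rw [e1]
    linarith
  have h := key (A / Z)
  have e : B / Z - (A / Z) ^ 2 = (B - 2 * (A / Z) * A + (A / Z) ^ 2 * Z) / Z := by
    field_simp
    ring
  rw [e, le_div_iff₀ hZpos]
  exact h
end

section
/- There exists a constant C(d, n) > 0, depending only on d and n, such that for every s ≥ 0, every polynomial f of degree at most d on ℝ that vanishes at some point τ ∈ [s, s+1], and every real number r, one has ∫_s^{s+1} |f(t)| t^n dt ≤ C(d, n) · ∫_s^{s+1} |f(t) − r| t^n dt. -/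
open MeasureTheory

lemma aux_bound (d n : ℕ) : ∃ K : ℝ, 0 < K ∧ ∀ p : Polynomial ℝ, p.natDegree ≤ d →
    ∀ x ∈ Set.Icc (0:ℝ) 1, |p.eval x| ≤ K * ∫ u in (0:ℝ)..1, |p.eval u| * u ^ n := by
  let E : (Fin (d+1) → ℝ) → ℝ → ℝ := fun c u => ∑ i, c i * u ^ (i:ℕ)
  let N : (Fin (d+1) → ℝ) → ℝ := fun c => ∫ u in (0:ℝ)..1, |E c u| * u ^ n
  have hE : Continuous (fun q : (Fin (d+1) → ℝ) × ℝ => E q.1 q.2) := by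
    simp only [E]; fun_prop
  have hN : Continuous N := by
    apply intervalIntegral.continuous_parametric_intervalIntegral_of_continuous'
    exact (hE.abs.mul (continuous_snd.pow n))
  have hsmul : ∀ (a : ℝ) c, N (a • c) = |a| * N c := by
    intro a c
    simp only [N]
    rw [← intervalIntegral.integral_const_mul]
    congr 1; ext u
    have : E (a • c) u = a * E c u := by
      simp [E, Finset.mul_sum, mul_assoc]
    rw [this, abs_mul, mul_assoc]
  have hpos : ∀ c, c ≠ 0 → 0 < N c := by
    intro c hc
    let p : Polynomial ℝ := ∑ i : Fin (d+1), Polynomial.C (c i) * Polynomial.X ^ (i:ℕ)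
    have hpe : ∀ u, p.eval u = E c u := by
      intro u; simp [p, E, Polynomial.eval_finset_sum]
    have hp0 : p ≠ 0 := by
      intro h
      apply hc
      ext j
      have : p.coeff j = 0 := by rw [h]; simp
      simpa [p, Polynomial.finset_sum_coeff, Polynomial.coeff_C_mul, Polynomial.coeff_X_pow,
        Fin.val_inj] using this
    have hex : ∃ u ∈ Set.Ioo (0:ℝ) 1, p.eval u ≠ 0 := by
      by_contra! h
      exact hp0 (p.eq_zero_of_infinite_isRoot ((Set.Ioo_infinite (zero_lt_one' ℝ)).mono h))
    obtain ⟨u, hu, hu'⟩ := hex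
    apply intervalIntegral.integral_pos zero_lt_one
    · have : Continuous (E c) := by simp only [E]; fun_prop
      fun_prop
    · intro x hx; have := hx.1.le; positivity
    · refine ⟨u, ⟨hu.1.le, hu.2.le⟩, ?_⟩
      rw [← hpe]
      have := hu.1
      positivity
  obtain ⟨c₀, hc₀, hmin⟩ := (isCompact_sphere (0 : Fin (d+1) → ℝ) 1).exists_isMinOn
    (NormedSpace.sphere_nonempty.2 zero_le_one) hN.continuousOn
  have hm : 0 < N c₀ := hpos c₀ (by
    rintro rfl; simp at hc₀)
  have hlow : ∀ c, ‖c‖ * N c₀ ≤ N c := by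
    intro c
    by_cases hc : c = 0
    · subst hc; have := hsmul 0 0; simp at this; simp [this]
    have h0 : 0 < ‖c‖ := norm_pos_iff.2 hc
    have : N c₀ ≤ N (‖c‖⁻¹ • c) := hmin (by simp [norm_smul, h0.ne'])
    rw [hsmul, abs_of_pos (inv_pos.2 h0)] at this
    calc ‖c‖ * N c₀ ≤ ‖c‖ * (‖c‖⁻¹ * N c) := by gcongr
      _ = N c := by field_simp
  refine ⟨(d+1) / N c₀, by positivity, fun p hp x hx => ?_⟩
  let c : Fin (d+1) → ℝ := fun i => p.coeff i
  have hpe : ∀ u, p.eval u = E c u := by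
    intro u
    rw [Polynomial.eval_eq_sum_range' (Nat.lt_succ_of_le hp), Finset.sum_range]
  have hNc : ∫ u in (0:ℝ)..1, |p.eval u| * u ^ n = N c := by simp only [hpe, N]
  rw [hNc, hpe]
  have h1 : |E c x| ≤ (d+1) * ‖c‖ := by
    calc |E c x| ≤ ∑ i, |c i * x ^ (i:ℕ)| := Finset.abs_sum_le_sum_abs _ _
      _ ≤ ∑ i : Fin (d+1), ‖c‖ := by
        apply Finset.sum_le_sum
        intro i _
        rw [abs_mul, abs_of_nonneg (pow_nonneg hx.1 _)]
        calc |c i| * x ^ (i:ℕ) ≤ |c i| * 1 := by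
              gcongr; exact pow_le_one₀ hx.1 hx.2
          _ ≤ ‖c‖ := by rw [mul_one]; exact norm_le_pi_norm c i
      _ = _ := by simp
  refine h1.trans ?_
  rw [div_mul_eq_mul_div, le_div_iff₀ hm, mul_assoc]
  gcongr
  exact hlow c

/-- Lemma 3.3: there is `C(d,n) > 0` such that for every `s ≥ 0`, every polynomial `f` of
degree at most `d` that vanishes at some `τ ∈ [s, s+1]`, and every real `r`,
`∫_s^{s+1} |f(t)| tⁿ dt ≤ C(d,n) ∫_s^{s+1} |f(t) - r| tⁿ dt`. -/
theorem shift_comparison_for_vanishing_polynomials (d n : ℕ) :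
    ∃ C : ℝ, 0 < C ∧
      ∀ s : ℝ, 0 ≤ s →
        ∀ f : Polynomial ℝ, f.natDegree ≤ d →
          (∃ τ ∈ Set.Icc s (s + 1), f.eval τ = 0) →
          ∀ r : ℝ,
            (∫ t in s..(s + 1), |f.eval t| * t ^ n) ≤
              C * ∫ t in s..(s + 1), |f.eval t - r| * t ^ n := by
  obtain ⟨K, hK, hb⟩ := aux_bound d n
  refine ⟨1 + K, by positivity, ?_⟩
  rintro s hs f hf ⟨τ, hτ, hfτ⟩ r
  let p : Polynomial ℝ := f.comp (Polynomial.X + Polynomial.C s) - Polynomial.C r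
  have hp : p.natDegree ≤ d := by
    refine (Polynomial.natDegree_sub_C).trans_le ?_
    rw [Polynomial.natDegree_comp]
    simpa using hf
  have hpe : ∀ u, p.eval u = f.eval (u + s) - r := by intro u; simp [p]
  have hr := hb p hp (τ - s) ⟨by linarith [hτ.1], by linarith [hτ.2]⟩
  rw [hpe, sub_add_cancel, hfτ, zero_sub, abs_neg] at hr
  have cf : Continuous (fun t => f.eval t) := f.continuous
  have hshift : ∫ u in (0:ℝ)..1, |p.eval u| * (u + s) ^ n
      = ∫ t in s..(s + 1), |f.eval t - r| * t ^ n := by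
    have := intervalIntegral.integral_comp_add_right (a := 0) (b := 1)
      (fun t => |f.eval t - r| * t ^ n) s
    simp only [hpe]
    rw [this, zero_add, add_comm 1 s]
  have hw : (s+1) ^ n * ∫ u in (0:ℝ)..1, |p.eval u| * u ^ n
      ≤ ∫ t in s..(s + 1), |f.eval t - r| * t ^ n := by
    rw [← hshift, ← intervalIntegral.integral_const_mul]
    have cp : Continuous (fun t => p.eval t) := p.continuous
    apply intervalIntegral.integral_mono_on zero_le_one
    · exact Continuous.intervalIntegrable (by fun_prop) _ _
    · exact Continuous.intervalIntegrable (by fun_prop) _ _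
    · intro u hu
      rw [mul_left_comm, ← mul_pow]
      have h0 := hu.1
      have : (s+1) * u ≤ u + s := by nlinarith [hu.2]
      gcongr
  have hmain : (∫ t in s..(s + 1), |f.eval t| * t ^ n) ≤
      ∫ t in s..(s + 1), (|f.eval t - r| * t ^ n + |r| * (s+1) ^ n) := by
    apply intervalIntegral.integral_mono_on (by linarith)
    · exact Continuous.intervalIntegrable (by fun_prop) _ _
    · exact Continuous.intervalIntegrable (by fun_prop) _ _
    · intro t ht
      have ht0 : 0 ≤ t := hs.trans ht.1
      have h1 : |f.eval t| ≤ |f.eval t - r| + |r| := by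
        simpa using abs_add_le (f.eval t - r) r
      have h2 : t ^ n ≤ (s+1) ^ n := by gcongr; exact ht.2
      calc |f.eval t| * t ^ n ≤ (|f.eval t - r| + |r|) * t ^ n := by gcongr
        _ = |f.eval t - r| * t ^ n + |r| * t ^ n := by ring
        _ ≤ _ := by gcongr
  rw [intervalIntegral.integral_add (Continuous.intervalIntegrable (by fun_prop) _ _)
    (Continuous.intervalIntegrable (by fun_prop) _ _)] at hmain
  simp only [intervalIntegral.integral_const, add_sub_cancel_left, one_smul] at hmain
  have h3 : |r| * (s+1) ^ n ≤ K * ((s+1) ^ n * ∫ u in (0:ℝ)..1, |p.eval u| * u ^ n) := by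
    calc _ ≤ (K * ∫ u in (0:ℝ)..1, |p.eval u| * u ^ n) * (s+1) ^ n := by gcongr
      _ = _ := by ring
  have h4 := mul_le_mul_of_nonneg_left hw hK.le
  linarith
end

section
/- For every d ≥ 1 and natural number n there exists a constant c(d, n) > 0, depending only on d and n, such that for every s ≥ 0, every ε > 0, every real number r, and every polynomial f of degree at most d on ℝ, one has ε · (∫_s^{s+1} t^n 1_{{f ≤ −ε}}(t) dt) · (∫_s^{s+1} t^n 1_{{f ≥ ε}}(t) dt) ≤ c(d, n) · (∫_s^{s+1} t^n 1_{{|f| < ε}}(t) dt) · (∫_s^{s+1} t^n |f(t) − r| dt). -/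
open MeasureTheory

lemma pwl_int (n : ℕ) {S : Set ℝ} (hS : MeasurableSet S) (a b : ℝ) :
    IntervalIntegrable (fun t : ℝ => t ^ n * Set.indicator S (fun _ => (1:ℝ)) t) volume a b := by
  have h : (fun t : ℝ => t ^ n * Set.indicator S (fun _ => (1:ℝ)) t)
      = Set.indicator S (fun t : ℝ => t ^ n) := by
    ext t
    by_cases ht : t ∈ S <;> simp [ht]
  rw [h]
  have h2 : IntervalIntegrable (fun t : ℝ => t ^ n) volume a b :=
    (continuous_pow n).intervalIntegrable a b
  rw [intervalIntegrable_iff] at h2 ⊢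
  exact h2.indicator hS

/-- norm equivalence, giving a Markov type inequality -/
lemma pwl_markov_s12 (d : ℕ) : ∃ K : ℝ, 0 < K ∧ ∀ p : Polynomial ℝ, p.natDegree ≤ d →
    ∀ t ∈ Set.Icc (0:ℝ) 1, |p.derivative.eval t| ≤ K * ∫ u in (1/2:ℝ)..1, |p.eval u| := by
  let P : (Fin (d+1) → ℝ) → ℝ → ℝ := fun v u => ∑ i, v i * u ^ (i : ℕ)
  let N : (Fin (d+1) → ℝ) → ℝ := fun v => ∫ u in (1/2:ℝ)..1, |P v u|
  have hPc : Continuous (fun q : (Fin (d+1) → ℝ) × ℝ => |P q.1 q.2|) := by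
    simp only [P]; fun_prop
  have hNc : Continuous N :=
    intervalIntegral.continuous_parametric_intervalIntegral_of_continuous' (f := fun v u => |P v u|) hPc _ _
  have hPv : ∀ v, Continuous (fun u => |P v u|) := fun v => by simp only [P]; fun_prop
  have hpos : ∀ v, v ≠ 0 → 0 < N v := by
    intro v hv
    let q : Polynomial ℝ := ∑ i : Fin (d+1), Polynomial.C (v i) * Polynomial.X ^ (i:ℕ)
    have hq : ∀ u, q.eval u = P v u := by
      intro u; simp [q, P, Polynomial.eval_finset_sum]
    have hq0 : q ≠ 0 := by
      intro h
      apply hv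
      ext j
      have : q.coeff j = v j := by
        simp only [q, Polynomial.finset_sum_coeff, Polynomial.coeff_C_mul_X_pow]
        simp [Fin.val_inj]
      rw [← this, h]; simp
    have : ∃ c ∈ Set.Icc (1/2:ℝ) 1, 0 < |P v c| := by
      by_contra hcon
      push Not at hcon
      apply hq0
      apply Polynomial.eq_zero_of_infinite_isRoot
      refine (Set.Icc_infinite (show (1/2:ℝ) < 1 by norm_num)).mono ?_
      intro c hc
      have := hcon c hc
      have h0 : P v c = 0 := abs_eq_zero.mp (le_antisymm this (abs_nonneg _))
      simp [Polynomial.IsRoot, hq, h0]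
    exact intervalIntegral.integral_pos (by norm_num) (hPv v).continuousOn
      (fun _ _ => abs_nonneg _) this
  obtain ⟨v0, hv0, hmin⟩ := (isCompact_sphere (0 : Fin (d+1) → ℝ) 1).exists_isMinOn
    (NormedSpace.sphere_nonempty.mpr zero_le_one) hNc.continuousOn
  have hv0' : v0 ≠ 0 := by
    rintro rfl
    simp at hv0
  have hm := hpos v0 hv0'
  have hlow : ∀ v, N v0 * ‖v‖ ≤ N v := by
    intro v
    by_cases hv : v = 0
    · subst hv; simp [N, P]
    have hn : 0 < ‖v‖ := norm_pos_iff.mpr hv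
    have h1 : N v0 ≤ N (‖v‖⁻¹ • v) := by
      apply hmin
      simp [norm_smul, hn.ne']
    have h2 : N (‖v‖⁻¹ • v) = ‖v‖⁻¹ * N v := by
      simp only [N]
      rw [← intervalIntegral.integral_const_mul]
      congr 1
      ext u
      have : P (‖v‖⁻¹ • v) u = ‖v‖⁻¹ * P v u := by
        simp [P, Finset.mul_sum, mul_assoc]
      rw [this, abs_mul, abs_of_pos (inv_pos.mpr hn)]
    rw [h2] at h1
    calc N v0 * ‖v‖ ≤ (‖v‖⁻¹ * N v) * ‖v‖ := by gcongr
      _ = N v := by field_simp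
  refine ⟨((d+1) * (d+1)) / N v0, by positivity, ?_⟩
  intro p hp t ht
  let v : Fin (d+1) → ℝ := fun i => p.coeff i
  have hpv : ∀ u, p.eval u = P v u := by
    intro u
    rw [Polynomial.eval_eq_sum_range' (Nat.lt_succ_of_le hp), Finset.sum_range]
  have hNv : (∫ u in (1/2:ℝ)..1, |p.eval u|) = N v := by simp only [N, hpv]
  rw [hNv]
  have hder : |p.derivative.eval t| ≤ (d+1) * (d+1) * ‖v‖ := by
    have hp' : p = ∑ i : Fin (d+1), Polynomial.C (v i) * Polynomial.X ^ (i:ℕ) := by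
      conv_lhs => rw [Polynomial.as_sum_range' p (d+1) (Nat.lt_succ_of_le hp), Finset.sum_range]
      simp [v, Polynomial.C_mul_X_pow_eq_monomial]
    rw [hp', Polynomial.derivative_sum, Polynomial.eval_finset_sum]
    refine (Finset.abs_sum_le_sum_abs _ _).trans ?_
    have : ∀ i ∈ (Finset.univ : Finset (Fin (d+1))), |(Polynomial.derivative (Polynomial.C (v i) * Polynomial.X ^ (i:ℕ))).eval t| ≤ (d+1) * ‖v‖ := by
      intro i _
      simp only [Polynomial.derivative_C_mul_X_pow, Polynomial.eval_mul, Polynomial.eval_C, Polynomial.eval_pow, Polynomial.eval_X, abs_mul]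
      have h1 : |v i| ≤ ‖v‖ := norm_le_pi_norm v i
      have h2 : |((i:ℕ):ℝ)| ≤ d + 1 := by
        rw [abs_of_nonneg (by positivity)]
        exact_mod_cast i.2.le
      have h3 : |t ^ ((i:ℕ) - 1)| ≤ 1 := by
        rw [abs_of_nonneg (pow_nonneg ht.1 _)]
        exact pow_le_one₀ ht.1 ht.2
      calc |v i| * |((i:ℕ):ℝ)| * |t ^ ((i:ℕ) - 1)| ≤ ‖v‖ * (d+1) * 1 := by gcongr
        _ = _ := by ring
    refine (Finset.sum_le_sum this).trans ?_
    simp [mul_assoc]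
  calc _ ≤ _ := hder
    _ = ((d+1) * (d+1)) / N v0 * (N v0 * ‖v‖) := by field_simp
    _ ≤ _ := by gcongr; exact hlow v

lemma pwl_ind_le (S : Set ℝ) (t : ℝ) : Set.indicator S (fun _ => (1:ℝ)) t ≤ 1 :=
  Set.indicator_le_self' (fun _ _ => zero_le_one) t

lemma pwl_ind_nonneg (S : Set ℝ) (t : ℝ) : 0 ≤ Set.indicator S (fun _ => (1:ℝ)) t :=
  Set.indicator_nonneg (fun _ _ => zero_le_one) t

lemma pwl_side (n : ℕ) {s ε M : ℝ} (hs : 0 ≤ s) (hε : 0 < ε) {f : ℝ → ℝ} (hf : Continuous f)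
    (hL : ∀ x ∈ Set.Icc s (s+1), ∀ y ∈ Set.Icc s (s+1), |f x - f y| ≤ M * |x - y|)
    {a b : ℝ} (ha : a ∈ Set.Icc s (s+1)) (hb : b ∈ Set.Icc s (s+1)) (hab : a < b)
    (hfa : f a ≤ -ε) (hfb : ε ≤ f b) (hmax : ∀ x ∈ Set.Icc s (s+1), f x ≤ -ε → x ≤ a) :
    ε * (∫ t in s..(s + 1), t ^ n * Set.indicator {u : ℝ | f u ≤ -ε} (fun _ => (1:ℝ)) t) ≤
      M * (∫ t in s..(s + 1), t ^ n * Set.indicator {u : ℝ | |f u| < ε} (fun _ => (1:ℝ)) t) := by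
  have hA : MeasurableSet {u : ℝ | f u ≤ -ε} := (isClosed_le hf continuous_const).measurableSet
  have hC : MeasurableSet {u : ℝ | |f u| < ε} := (isOpen_lt hf.abs continuous_const).measurableSet
  have ha0 : 0 ≤ a := hs.trans ha.1
  have hba := hL b hb a ha
  rw [abs_of_pos (by linarith : 0 < f b - f a), abs_of_pos (by linarith : 0 < b - a)] at hba
  have hM : 0 < M := by
    by_contra h
    push Not at h
    nlinarith
  have hδ : 0 < ε / M := by positivity
  have hMδ : M * (ε / M) = ε := by field_simp
  have hδb : a + ε / M ≤ b := by
    by_contra h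
    push Not at h
    nlinarith
  have h1 : (∫ t in s..(s + 1), t ^ n * Set.indicator {u : ℝ | f u ≤ -ε} (fun _ => (1:ℝ)) t) ≤ a ^ n := by
    calc _ ≤ ∫ t in s..(s+1), a ^ n := by
          refine intervalIntegral.integral_mono_on (by linarith) (pwl_int n hA _ _) (by simp) ?_
          intro x hx
          by_cases hxA : f x ≤ -ε
          · have := hmax x hx hxA
            have h0 : 0 ≤ x := hs.trans hx.1
            simp only [Set.indicator, Set.mem_setOf_eq, hxA, if_true, mul_one]
            gcongr
          · simp only [Set.indicator, Set.mem_setOf_eq, hxA, if_false, mul_zero]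
            positivity
      _ = a ^ n := by simp
  have h2 : ε / M * a ^ n ≤ (∫ t in s..(s + 1), t ^ n * Set.indicator {u : ℝ | |f u| < ε} (fun _ => (1:ℝ)) t) := by
    calc ε / M * a ^ n = ∫ t in a..(a + ε / M), a ^ n := by simp
      _ ≤ ∫ t in a..(a + ε / M), t ^ n * Set.indicator {u : ℝ | |f u| < ε} (fun _ => (1:ℝ)) t := by
          refine intervalIntegral.integral_mono_on_of_le_Ioo (by linarith) (by simp) (pwl_int n hC _ _) ?_
          intro x hx
          have hxI : x ∈ Set.Icc s (s+1) := ⟨by linarith [ha.1, hx.1], by linarith [hx.2, hb.2]⟩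
          have hxl := (le_abs_self _).trans (hL x hxI a ha)
          rw [abs_of_pos (by linarith [hx.1] : 0 < x - a)] at hxl
          have h3 : M * (x - a) < ε := by
            rw [← hMδ]; gcongr; linarith [hx.2]
          have h4 : -ε < f x := by
            by_contra h
            push Not at h
            linarith [hmax x hxI h, hx.1]
          have h5 : |f x| < ε := abs_lt.mpr ⟨h4, by linarith⟩
          simp only [Set.indicator, Set.mem_setOf_eq, h5, if_true, mul_one]
          have := hx.1.le
          gcongr
      _ ≤ _ := by
          refine intervalIntegral.integral_mono_interval ha.1 (by linarith) (by linarith [hb.2]) ?_ (pwl_int n hC _ _)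
          filter_upwards [ae_restrict_mem measurableSet_Ioc] with x hx
          have h0 : 0 ≤ x := by linarith [hx.1]
          have := pwl_ind_nonneg {u : ℝ | |f u| < ε} x
          simp only [Pi.zero_apply]
          positivity
  calc _ ≤ ε * a ^ n := by gcongr
    _ = M * (ε / M * a ^ n) := by rw [← mul_assoc, hMδ]
    _ ≤ _ := by gcongr

lemma pwl_zero (n : ℕ) {s : ℝ} {S : Set ℝ} (h : ¬ (Set.Icc s (s+1) ∩ S).Nonempty) :
    (∫ t in s..(s + 1), t ^ n * Set.indicator S (fun _ => (1:ℝ)) t) = 0 := by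
  rw [intervalIntegral.integral_congr (g := fun _ => (0:ℝ))]
  · simp
  · intro x hx
    rw [Set.uIcc_of_le (by linarith)] at hx
    have : x ∉ S := fun hxS => h ⟨x, hx, hxS⟩
    simp [this]

lemma pwl_nonneg (n : ℕ) {s : ℝ} (hs : 0 ≤ s) (S : Set ℝ) :
    0 ≤ (∫ t in s..(s + 1), t ^ n * Set.indicator S (fun _ => (1:ℝ)) t) := by
  refine intervalIntegral.integral_nonneg (by linarith) ?_
  intro x hx
  have h0 : 0 ≤ x := by linarith [hx.1]
  have := pwl_ind_nonneg S x
  positivity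

lemma pwl_le (n : ℕ) {s : ℝ} (hs : 0 ≤ s) {S : Set ℝ} (hS : MeasurableSet S) :
    (∫ t in s..(s + 1), t ^ n * Set.indicator S (fun _ => (1:ℝ)) t) ≤ (s+1) ^ n := by
  calc _ ≤ ∫ t in s..(s+1), (s+1) ^ n := by
        refine intervalIntegral.integral_mono_on (by linarith) (pwl_int n hS _ _) (by simp) ?_
        intro x hx
        have h0 : 0 ≤ x := hs.trans hx.1
        calc _ ≤ x ^ n * 1 := by gcongr; exact pwl_ind_le S x
          _ ≤ _ := by rw [mul_one]; gcongr; exact hx.2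
    _ = _ := by simp

lemma pwl_main (n : ℕ) {s ε M : ℝ} (hs : 0 ≤ s) (hε : 0 < ε) (hM : 0 ≤ M) {f : ℝ → ℝ} (hf : Continuous f)
    (hL : ∀ x ∈ Set.Icc s (s+1), ∀ y ∈ Set.Icc s (s+1), |f x - f y| ≤ M * |x - y|) :
    ε * (∫ t in s..(s + 1), t ^ n * Set.indicator {u : ℝ | f u ≤ -ε} (fun _ => (1:ℝ)) t) *
      (∫ t in s..(s + 1), t ^ n * Set.indicator {u : ℝ | ε ≤ f u} (fun _ => (1:ℝ)) t) ≤
      M * (∫ t in s..(s + 1), t ^ n * Set.indicator {u : ℝ | |f u| < ε} (fun _ => (1:ℝ)) t) * (s+1) ^ n := by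
  have hA : IsClosed {u : ℝ | f u ≤ -ε} := isClosed_le hf continuous_const
  have hB : IsClosed {u : ℝ | ε ≤ f u} := isClosed_le continuous_const hf
  have nA := pwl_nonneg n hs {u : ℝ | f u ≤ -ε}
  have nB := pwl_nonneg n hs {u : ℝ | ε ≤ f u}
  have nC := pwl_nonneg n hs {u : ℝ | |f u| < ε}
  have lA := pwl_le n hs hA.measurableSet
  have lB := pwl_le n hs hB.measurableSet
  by_cases eA : (Set.Icc s (s+1) ∩ {u : ℝ | f u ≤ -ε}).Nonempty
  swap
  · rw [pwl_zero n eA]; simp only [mul_zero, zero_mul]; positivity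
  by_cases eB : (Set.Icc s (s+1) ∩ {u : ℝ | ε ≤ f u}).Nonempty
  swap
  · rw [pwl_zero n eB]; simp only [mul_zero]; positivity
  obtain ⟨a, ⟨haI, haA⟩, hamax⟩ := (isCompact_Icc.inter_right hA).exists_isGreatest eA
  obtain ⟨b, ⟨hbI, hbB⟩, hbmax⟩ := (isCompact_Icc.inter_right hB).exists_isGreatest eB
  simp only [Set.mem_setOf_eq] at haA hbB
  rcases lt_trichotomy a b with h | h | h
  · have := pwl_side n hs hε hf hL haI hbI h haA hbB (fun x hx hxA => hamax ⟨hx, hxA⟩)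
    gcongr
  · subst h; linarith
  · have := pwl_side n (f := fun u => - f u) hs hε hf.neg (M := M)
      (fun x hx y hy => by
        have := hL x hx y hy
        rwa [← abs_neg, show -(- f x - - f y) = f x - f y by ring])
      hbI haI h (by linarith) (by linarith) (fun x hx hxA => hbmax ⟨hx, by simpa using hxA⟩)
    simp only [neg_le_neg_iff, abs_neg] at this
    calc _ = ε * (∫ t in s..(s + 1), t ^ n * Set.indicator {u : ℝ | ε ≤ f u} (fun _ => (1:ℝ)) t) *
          (∫ t in s..(s + 1), t ^ n * Set.indicator {u : ℝ | f u ≤ -ε} (fun _ => (1:ℝ)) t) := by ring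
      _ ≤ _ := by gcongr


/-- Corollary 3.4: for every `d ≥ 1` and `n` there is `c(d,n) > 0` such that for every
`s ≥ 0`, `ε > 0`, every real `r` and every polynomial `f` of degree at most `d`,
`ε ∫_s^{s+1} tⁿ 1_{f ≤ -ε} dt · ∫_s^{s+1} tⁿ 1_{f ≥ ε} dt ≤
 c(d,n) ∫_s^{s+1} tⁿ 1_{|f| < ε} dt · ∫_s^{s+1} tⁿ |f(t) - r| dt`. -/
theorem power_weight_localization_shifted (d n : ℕ) (hd : 1 ≤ d) :
    ∃ c : ℝ, 0 < c ∧
      ∀ s : ℝ, 0 ≤ s → ∀ ε : ℝ, 0 < ε → ∀ r : ℝ,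
        ∀ f : Polynomial ℝ, f.natDegree ≤ d →
          ε * (∫ t in s..(s + 1), t ^ n *
                Set.indicator {u : ℝ | f.eval u ≤ -ε} (fun _ => (1:ℝ)) t) *
              (∫ t in s..(s + 1), t ^ n *
                Set.indicator {u : ℝ | ε ≤ f.eval u} (fun _ => (1:ℝ)) t) ≤
            c * (∫ t in s..(s + 1), t ^ n *
                Set.indicator {u : ℝ | |f.eval u| < ε} (fun _ => (1:ℝ)) t) *
              (∫ t in s..(s + 1), t ^ n * |f.eval t - r|) := by
  obtain ⟨K, hK, hmk⟩ := pwl_markov_s12 d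
  refine ⟨K * 2 ^ n, by positivity, ?_⟩
  intro s hs ε hε r f hfd
  let g : Polynomial ℝ := f.comp (Polynomial.X + Polynomial.C s) - Polynomial.C r
  have hg : ∀ u, g.eval u = f.eval (u + s) - r := by intro u; simp [g]
  have hgd : g.natDegree ≤ d := by
    simp only [g, Polynomial.natDegree_sub_C]
    rw [Polynomial.natDegree_comp, Polynomial.natDegree_X_add_C, mul_one]
    exact hfd
  have hgder : ∀ u, g.derivative.eval u = f.derivative.eval (u + s) := by
    intro u; simp [g, Polynomial.derivative_comp]
  set Q := ∫ u in (1/2:ℝ)..1, |g.eval u| with hQ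
  have hQ0 : 0 ≤ Q := intervalIntegral.integral_nonneg (by norm_num) (fun _ _ => abs_nonneg _)
  have hL : ∀ x ∈ Set.Icc s (s+1), ∀ y ∈ Set.Icc s (s+1),
      |f.eval x - f.eval y| ≤ (K * Q) * |x - y| := by
    intro x hx y hy
    refine (convex_Icc s (s+1)).norm_image_sub_le_of_norm_deriv_le (f := fun u => f.eval u)
      (fun u _ => f.differentiableAt) ?_ hy hx
    intro u hu
    rw [Polynomial.deriv]
    have := hmk g hgd (u - s) ⟨by linarith [hu.1], by linarith [hu.2]⟩
    rwa [hgder, sub_add_cancel] at this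
  have hmain := pwl_main n hs hε (by positivity) f.continuous hL
  have hlast : (s+1) ^ n * Q ≤ 2 ^ n * ∫ t in s..(s + 1), t ^ n * |f.eval t - r| := by
    have hc : Continuous (fun t : ℝ => t ^ n * |f.eval t - r|) := by
      have := f.continuous
      fun_prop
    have e : Q = ∫ t in (1/2 + s)..(1 + s), |f.eval t - r| := by
      rw [← intervalIntegral.integral_comp_add_right (fun t => |f.eval t - r|)]
      simp only [hQ, hg]
    calc (s+1) ^ n * Q = ∫ t in (1/2 + s)..(1 + s), (s+1) ^ n * |f.eval t - r| := by
          rw [intervalIntegral.integral_const_mul, e]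
      _ ≤ ∫ t in (1/2 + s)..(1 + s), 2 ^ n * (t ^ n * |f.eval t - r|) := by
          refine intervalIntegral.integral_mono_on (by linarith)
            (Continuous.intervalIntegrable (by have := f.continuous; fun_prop) _ _)
            (Continuous.intervalIntegrable (by fun_prop) _ _) ?_
          intro x hx
          rw [← mul_assoc, ← mul_pow]
          gcongr
          linarith [hx.1]
      _ = 2 ^ n * ∫ t in (1/2 + s)..(1 + s), t ^ n * |f.eval t - r| := by
          rw [intervalIntegral.integral_const_mul]
      _ ≤ _ := by
          gcongr
          refine intervalIntegral.integral_mono_interval (by linarith) (by linarith) (by linarith) ?_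
            (hc.intervalIntegrable _ _)
          filter_upwards [ae_restrict_mem measurableSet_Ioc] with x hx
          have h0 : 0 ≤ x := by linarith [hx.1]
          simp only [Pi.zero_apply]
          positivity
  have nC := pwl_nonneg n hs {u : ℝ | |f.eval u| < ε}
  refine hmain.trans ?_
  set Cc := ∫ t in s..(s + 1), t ^ n * Set.indicator {u : ℝ | |f.eval u| < ε} (fun _ => (1:ℝ)) t
  calc K * Q * Cc * (s+1) ^ n = K * Cc * ((s+1) ^ n * Q) := by ring
    _ ≤ K * Cc * (2 ^ n * ∫ t in s..(s + 1), t ^ n * |f.eval t - r|) := by gcongr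
    _ = _ := by ring
end
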